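/- arXiv:0810.1064 — 2 statements merged into one kernel-verified Lean document; each statement's English description precedes it below -/
import Mathlib

section
/- Every multiple polylogarithm value of weight 3 and level 4 (i.e., every value Li_{s_1,…,s_n}(ζ_1,…,ζ_n) with s_1+⋯+s_n = 3 and all ζ_j fourth roots of unity, (s_1,ζ_1) ≠ (1,1)) is a ℚ-linear combination of the following nine values: Li_{1,2}(−1,−i), Li_{1,1,1}(i,1,1), Li_{1,1,1}(−1,−1,i), Li_{1,1,1}(i,i,i), Li_{1,2}(−i,i), Li_{1,1,1}(−i,−1,1), Li_{1,1,1}(−i,1,1), Li_{1,1,1}(i,i,−1), Li_{2,1}(−i,1). In particular d(3,4) ≤ 9. -/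
open Filter Topology

/-- `mpvPartial l m` is the finite iterated sum
`∑_{m > k₁ > k₂ > ⋯ > kₙ > 0} ∏ⱼ ζⱼ^{kⱼ} / kⱼ^{sⱼ}`, where `l = [(s₁,ζ₁),…,(sₙ,ζₙ)]`,
i.e. the partial sum (in the outermost variable `k₁`) of the multiple
polylogarithm series; the inner sums are finite. -/
noncomputable def mpvPartial : List (ℕ × ℂ) → ℕ → ℂ
  | [], _ => 1
  | (s, z) :: t, m => ∑ k ∈ Finset.Ico 1 m, z ^ k / (k : ℂ) ^ s * mpvPartial t k

/-- The multiple polylogarithm value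
`Li_{s₁,…,sₙ}(ζ₁,…,ζₙ) = ∑_{k₁>⋯>kₙ>0} ζ₁^{k₁}⋯ζₙ^{kₙ} / (k₁^{s₁}⋯kₙ^{sₙ})`,
encoded by the list `l = [(s₁,ζ₁),…,(sₙ,ζₙ)]`: the limit of the sequence of
partial sums in the outermost summation variable. -/
noncomputable def Li (l : List (ℕ × ℂ)) : ℂ :=
  limUnder atTop (mpvPartial l)

/-- The set of all multiple polylogarithm values of weight `w` and level `N`:
values `Li_{s₁,…,sₙ}(ζ₁,…,ζₙ)` with all `sⱼ ≥ 1`, all `ζⱼ` being `N`-th roots of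
unity, total weight `s₁+⋯+sₙ = w`, and `(s₁,ζ₁) ≠ (1,1)`. -/
def MPVset (w N : ℕ) : Set ℂ :=
  {x | ∃ l : List (ℕ × ℂ),
    (∀ q ∈ l, 0 < q.1 ∧ q.2 ^ N = 1) ∧
    (l.map Prod.fst).sum = w ∧
    l.head? ≠ some (1, 1) ∧
    x = Li l}

/-- `MPV w N` is the `ℚ`-vector subspace of `ℂ` spanned by all multiple
polylogarithm values of weight `w` and level `N`. -/
noncomputable def MPV (w N : ℕ) : Submodule ℚ ℂ :=
  Submodule.span ℚ (MPVset w N)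


theorem mpvPartial_cons_succ {s : ℕ} (hs : 0 < s) (z : ℂ) (t : List (ℕ × ℂ)) (m : ℕ) :
    mpvPartial ((s, z) :: t) (m + 1)
      = mpvPartial ((s, z) :: t) m + z ^ m / (m : ℂ) ^ s * mpvPartial t m := by
  rcases Nat.eq_zero_or_pos m with rfl | hm
  · simp [mpvPartial, hs.ne']
  · simp only [mpvPartial]
    rw [Finset.sum_Ico_succ_top hm]

theorem mpvPartial_cons_zero (q : ℕ × ℂ) (t : List (ℕ × ℂ)) : mpvPartial (q :: t) 0 = 0 := by
  simp [mpvPartial]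

theorem mpvPartial_cons_one (q : ℕ × ℂ) (t : List (ℕ × ℂ)) : mpvPartial (q :: t) 1 = 0 := by
  simp [mpvPartial]

/-! ### Growth and convergence of partial sums -/

/-- The sequence `f` converges with error `O(1 / √m)`. -/
def ConvergesAtSqrtRate (f : ℕ → ℂ) : Prop :=
  ∃ (L : ℂ) (C : ℝ), ∀ m : ℕ, 1 ≤ m → ‖f m - L‖ ≤ C / √m

theorem ConvergesAtSqrtRate.exists_tendsto {f : ℕ → ℂ} (hf : ConvergesAtSqrtRate f) :
    ∃ L, Tendsto f atTop (𝓝 L) := by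
  obtain ⟨L, C, h⟩ := hf
  refine ⟨L, tendsto_iff_norm_sub_tendsto_zero.2 ?_⟩
  refine squeeze_zero' (Eventually.of_forall fun _ => norm_nonneg _)
    ((eventually_ge_atTop 1).mono h) ?_
  exact tendsto_const_nhds.div_atTop
    (Real.tendsto_sqrt_atTop.comp tendsto_natCast_atTop_atTop)

theorem inv_le_sqrt_succ_sub_sqrt (k : ℕ) : 1 / √((k : ℝ) + 1) ≤ 2 * (√((k : ℝ) + 1) - √k) := by
  have h1 : √((k : ℝ) + 1) ^ 2 = k + 1 := Real.sq_sqrt (by positivity)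
  have h2 : √(k : ℝ) ^ 2 = k := Real.sq_sqrt (by positivity)
  have h3 : 0 < √((k : ℝ) + 1) := by positivity
  rw [div_le_iff₀ h3]
  nlinarith [sq_nonneg (√((k : ℝ) + 1) - √k)]

theorem one_div_mul_sqrt_le {k : ℕ} (hk : 1 ≤ k) :
    1 / ((k : ℝ) * √k) ≤ 6 / √k - 6 / √((k : ℝ) + 1) := by
  have hk' : (1 : ℝ) ≤ k := by exact_mod_cast hk
  have h1 : √((k : ℝ) + 1) ^ 2 = k + 1 := Real.sq_sqrt (by positivity)
  have h2 : √(k : ℝ) ^ 2 = k := Real.sq_sqrt (by positivity)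
  have h3 : 0 < √((k : ℝ) + 1) := by positivity
  have h4 : 0 < √(k : ℝ) := by positivity
  have h5 : √((k : ℝ) + 1) ≤ 2 * √k := by
    apply Real.sqrt_le_iff.2 ⟨by positivity, by nlinarith⟩
  have h6 : 1 ≤ 6 * √(k : ℝ) ^ 2 * (√((k : ℝ) + 1) - √k) / √((k : ℝ) + 1) := by
    rw [le_div_iff₀ h3]
    have : (√((k : ℝ) + 1) - √k) * (√((k : ℝ) + 1) + √k) = 1 := by nlinarith
    have h7 : 1 ≤ (√((k : ℝ) + 1) - √k) * (3 * √k) :=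
      this.ge.trans (mul_le_mul_of_nonneg_left (by linarith)
        (sub_nonneg.2 (Real.sqrt_le_sqrt (by linarith))))
    nlinarith
  calc 1 / ((k : ℝ) * √k) = 1 / (√k ^ 2 * √k) * 1 := by rw [h2, mul_one]
    _ ≤ 1 / (√(k : ℝ) ^ 2 * √k) *
        (6 * √(k : ℝ) ^ 2 * (√((k : ℝ) + 1) - √k) / √((k : ℝ) + 1)) := by gcongr
    _ = _ := by field_simp

/-- A sequence whose increments are `O(k ^ (-3/2))` converges with error `O(1 / √m)`. -/
theorem convergesAtSqrtRate_of_increments {g : ℕ → ℂ} {C : ℝ}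
    (h : ∀ k : ℕ, 1 ≤ k → ‖g (k + 1) - g k‖ ≤ C / (k * √k)) : ConvergesAtSqrtRate g := by
  have hC : 0 ≤ C := by simpa using (norm_nonneg _).trans (h 1 le_rfl)
  have key : ∀ m n : ℕ, 1 ≤ m → m ≤ n → ‖g n - g m‖ ≤ 6 * C / √m - 6 * C / √n := by
    intro m n hm hmn
    induction n, hmn using Nat.le_induction with
    | base => simp
    | succ n hn ih =>
      have h1 : C / (n * √n) ≤ 6 * C / √n - 6 * C / √((n : ℝ) + 1) := by
        have := mul_le_mul_of_nonneg_left (one_div_mul_sqrt_le (hm.trans hn)) hC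
        calc C / (n * √n) = C * (1 / ((n : ℝ) * √n)) := by ring
          _ ≤ _ := this
          _ = _ := by ring
      have h2 := norm_add_le (g (n + 1) - g n) (g n - g m)
      rw [sub_add_sub_cancel] at h2
      have h3 := h n (hm.trans hn)
      push_cast
      linarith
  have key' : ∀ m n : ℕ, 1 ≤ m → m ≤ n → ‖g n - g m‖ ≤ 6 * C / √m := fun m n hm hmn =>
    (key m n hm hmn).trans (sub_le_self _ (by positivity))
  have hlim : Tendsto (fun m : ℕ => 6 * C / √(m : ℝ)) atTop (𝓝 0) :=
    tendsto_const_nhds.div_atTop (Real.tendsto_sqrt_atTop.comp tendsto_natCast_atTop_atTop)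
  have hc : CauchySeq fun k => g (k + 1) :=
    cauchySeq_of_le_tendsto_0' (fun m : ℕ => 6 * C / √((m + 1 : ℕ) : ℝ))
      (fun m n hmn => by
        rw [dist_comm, dist_eq_norm]
        exact key' _ _ (by omega) (by omega))
      (hlim.comp (tendsto_add_atTop_nat 1))
  obtain ⟨L, hL⟩ := cauchySeq_tendsto_of_complete hc
  have hL := (tendsto_add_atTop_iff_nat 1).1 hL
  refine ⟨L, 6 * C, fun m hm => ?_⟩
  rw [norm_sub_rev]
  exact le_of_tendsto (hL.sub_const (g m)).norm
    ((eventually_ge_atTop m).mono fun n hn => key' m n hm hn)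

theorem norm_pow_div_le {z : ℂ} (hz : ‖z‖ = 1) {s d : ℕ} (hs : d ≤ s) {k : ℕ} (hk : 1 ≤ k) :
    ‖z ^ k / (k : ℂ) ^ s‖ ≤ 1 / (k : ℝ) ^ d := by
  have : (1 : ℝ) ≤ k := by exact_mod_cast hk
  rw [norm_div, norm_pow, norm_pow, hz, one_pow, Complex.norm_natCast]
  gcongr

theorem exists_norm_mpvPartial_le (l : List (ℕ × ℂ)) (hl : ∀ q ∈ l, 0 < q.1 ∧ ‖q.2‖ = 1) :
    ∃ C : ℝ, ∀ m : ℕ, 1 ≤ m → ‖mpvPartial l m‖ ≤ C * √m := by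
  induction l with
  | nil => exact ⟨1, fun m hm => by simp [mpvPartial, hm]⟩
  | cons q t ih =>
    obtain ⟨s, z⟩ := q
    obtain ⟨⟨hs, hz⟩, ht⟩ := List.forall_mem_cons.1 hl
    obtain ⟨C, hC⟩ := ih ht
    have hC0 : 0 ≤ C := by simpa using (norm_nonneg _).trans (hC 1 le_rfl)
    refine ⟨4 * C, fun m hm => ?_⟩
    induction m, hm using Nat.le_induction with
    | base => simpa [mpvPartial_cons_one] using hC0
    | succ k hk ih =>
      rw [mpvPartial_cons_succ hs]
      have hk' : (1 : ℝ) ≤ k := by exact_mod_cast hk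
      have h1 : ‖z ^ k / (k : ℂ) ^ s * mpvPartial t k‖ ≤ C * (1 / √k) := by
        rw [norm_mul]
        calc _ ≤ 1 / (k : ℝ) ^ 1 * (C * √k) := by
              gcongr
              · exact norm_pow_div_le hz hs hk
              · exact hC k hk
          _ = C * (√k / k) := by ring
          _ = _ := by rw [Real.sqrt_div_self']
      have h2 : 1 / √(k : ℝ) ≤ 4 * (√((k : ℝ) + 1) - √k) := by
        have h3 : √((k : ℝ) + 1) ≤ 2 * √k :=
          Real.sqrt_le_iff.2 ⟨by positivity, by nlinarith [Real.sq_sqrt (zero_le_one.trans hk')]⟩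
        have h4 : 1 / √(k : ℝ) ≤ 2 * (1 / √((k : ℝ) + 1)) := by
          rw [mul_one_div, div_le_div_iff₀ (by positivity) (by positivity)]
          linarith
        linarith [inv_le_sqrt_succ_sub_sqrt k]
      have h5 := mul_le_mul_of_nonneg_left h2 hC0
      push_cast
      linarith [norm_add_le (mpvPartial ((s, z) :: t) k) (z ^ k / (k : ℂ) ^ s * mpvPartial t k)]

theorem exists_norm_mpvPartial_succ_sub_le (l : List (ℕ × ℂ))
    (hl : ∀ q ∈ l, 0 < q.1 ∧ ‖q.2‖ = 1) :
    ∃ C : ℝ, ∀ m : ℕ, 1 ≤ m → ‖mpvPartial l (m + 1) - mpvPartial l m‖ ≤ C / √m := by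
  cases l with
  | nil => exact ⟨0, fun m _ => by simp [mpvPartial]⟩
  | cons q t =>
    obtain ⟨s, z⟩ := q
    obtain ⟨⟨hs, hz⟩, ht⟩ := List.forall_mem_cons.1 hl
    obtain ⟨C, hC⟩ := exists_norm_mpvPartial_le t ht
    refine ⟨C, fun k hk => ?_⟩
    rw [mpvPartial_cons_succ hs, add_sub_cancel_left, norm_mul]
    calc _ ≤ 1 / (k : ℝ) ^ 1 * (C * √k) := by
          gcongr
          · exact norm_pow_div_le hz hs hk
          · exact hC k hk
      _ = C * (√k / k) := by ring
      _ = _ := by rw [Real.sqrt_div_self', mul_one_div]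

theorem convergesAtSqrtRate_mpvPartial {s : ℕ} {z : ℂ} {t : List (ℕ × ℂ)} (hs : 0 < s)
    (hz : ‖z‖ = 1) (ht : ∀ q ∈ t, 0 < q.1 ∧ ‖q.2‖ = 1) (hsz : 2 ≤ s ∨ z ≠ 1) :
    ConvergesAtSqrtRate (mpvPartial ((s, z) :: t)) := by
  obtain ⟨C, hC⟩ := exists_norm_mpvPartial_le t ht
  obtain ⟨C', hC'⟩ := exists_norm_mpvPartial_succ_sub_le t ht
  have hC0 : 0 ≤ C := by simpa using (norm_nonneg _).trans (hC 1 le_rfl)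
  have hC0' : 0 ≤ C' := by simpa using (norm_nonneg _).trans (hC' 1 le_rfl)
  by_cases h2 : 2 ≤ s
  · refine convergesAtSqrtRate_of_increments (C := C) fun k hk => ?_
    have hk' : (1 : ℝ) ≤ k := by exact_mod_cast hk
    rw [mpvPartial_cons_succ hs, add_sub_cancel_left, norm_mul]
    calc _ ≤ 1 / (k : ℝ) ^ 2 * (C * √k) := by
          gcongr
          · exact norm_pow_div_le hz h2 hk
          · exact hC k hk
      _ = C / k * (√k / k) := by ring
      _ = _ := by rw [Real.sqrt_div_self']; field_simp
  · obtain rfl : s = 1 := by omega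
    have hz1 : z - 1 ≠ 0 := sub_ne_zero.2 (hsz.resolve_left h2)
    have hd : 0 < ‖z - 1‖ := norm_pos_iff.2 hz1
    obtain ⟨L, D, hD⟩ := convergesAtSqrtRate_of_increments
      (g := fun m => mpvPartial ((1, z) :: t) m - z ^ m / (z - 1) * (mpvPartial t m / m))
      (C := (C + C') / ‖z - 1‖) fun k hk => by
        have hk' : (1 : ℝ) ≤ k := by exact_mod_cast hk
        have hk0 : (k : ℂ) ≠ 0 := by exact_mod_cast (by omega : k ≠ 0)
        have hk1 : (k : ℂ) + 1 ≠ 0 := by exact_mod_cast k.succ_ne_zero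
        have e : (mpvPartial ((1, z) :: t) (k + 1)
              - z ^ (k + 1) / (z - 1) * (mpvPartial t (k + 1) / ((k + 1 : ℕ) : ℂ)))
              - (mpvPartial ((1, z) :: t) k - z ^ k / (z - 1) * (mpvPartial t k / k))
            = z ^ (k + 1) / (z - 1) * (mpvPartial t k / (k * (k + 1))
              - (mpvPartial t (k + 1) - mpvPartial t k) / (k + 1)) := by
          rw [mpvPartial_cons_succ one_pos]
          push_cast
          field_simp
          ring
        rw [e, norm_mul, norm_div, norm_pow, hz, one_pow]
        have e1 : ‖(k : ℂ) + 1‖ = k + 1 := by exact_mod_cast Complex.norm_natCast (k + 1)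
        have b1 : ‖mpvPartial t k / (k * (k + 1))‖ ≤ C / (k * √k) := by
          rw [norm_div, norm_mul, e1, Complex.norm_natCast]
          calc _ ≤ C * √k / (k * k) := by
                gcongr
                · exact hC k hk
                · linarith
            _ = C / k * (√k / k) := by ring
            _ = _ := by rw [Real.sqrt_div_self']; field_simp
        have b2 : ‖(mpvPartial t (k + 1) - mpvPartial t k) / (k + 1)‖ ≤ C' / (k * √k) := by
          rw [norm_div, e1]
          calc _ ≤ C' / √k / k := by
                gcongr
                · exact hC' k hk
                · linarith
            _ = _ := by rw [div_div, mul_comm]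
        calc _ ≤ 1 / ‖z - 1‖ * (C / (k * √k) + C' / (k * √k)) := by
              gcongr
              exact (norm_sub_le _ _).trans (add_le_add b1 b2)
          _ = _ := by ring
    refine ⟨L, D + C / ‖z - 1‖, fun m hm => ?_⟩
    have hm' : (1 : ℝ) ≤ m := by exact_mod_cast hm
    have b : ‖z ^ m / (z - 1) * (mpvPartial t m / m)‖ ≤ C / ‖z - 1‖ / √m := by
      rw [norm_mul, norm_div, norm_div, norm_pow, hz, one_pow, Complex.norm_natCast]
      calc _ ≤ 1 / ‖z - 1‖ * (C * √m / m) := by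
            gcongr
            exact hC m hm
        _ = C / ‖z - 1‖ * (√m / m) := by ring
        _ = _ := by rw [Real.sqrt_div_self', mul_one_div]
    calc _ = ‖(mpvPartial ((1, z) :: t) m - z ^ m / (z - 1) * (mpvPartial t m / m) - L)
          + z ^ m / (z - 1) * (mpvPartial t m / m)‖ := by congr 1; ring
      _ ≤ D / √m + C / ‖z - 1‖ / √m := (norm_add_le _ _).trans (add_le_add (hD m hm) b)
      _ = _ := by ring

theorem tendsto_mpvPartial_Li {s : ℕ} {z : ℂ} {t : List (ℕ × ℂ)} (hs : 0 < s)
    (hz : ‖z‖ = 1) (ht : ∀ q ∈ t, 0 < q.1 ∧ ‖q.2‖ = 1) (hsz : 2 ≤ s ∨ z ≠ 1) :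
    Tendsto (mpvPartial ((s, z) :: t)) atTop (𝓝 (Li ((s, z) :: t))) :=
  tendsto_nhds_limUnder (convergesAtSqrtRate_mpvPartial hs hz ht hsz).exists_tendsto

/-! ### Stuffle and shuffle products with a value of weight one -/

theorem mpvPartial_stuffle_two (a b : ℂ) (m : ℕ) :
    mpvPartial [(1, a)] m * mpvPartial [(2, b)] m
      = mpvPartial [(1, a), (2, b)] m + mpvPartial [(2, b), (1, a)] m
        + mpvPartial [(3, a * b)] m := by
  induction m with
  | zero => simp [mpvPartial_cons_zero]
  | succ m ih =>
    simp only [mpvPartial_cons_succ one_pos, mpvPartial_cons_succ two_pos,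
      mpvPartial_cons_succ three_pos]
    have h : mpvPartial [] m = 1 := rfl
    rw [mul_pow, h]
    linear_combination ih

theorem mpvPartial_stuffle_one (a b : ℂ) (m : ℕ) :
    mpvPartial [(1, a)] m * mpvPartial [(1, b)] m
      = mpvPartial [(1, a), (1, b)] m + mpvPartial [(1, b), (1, a)] m
        + mpvPartial [(2, a * b)] m := by
  induction m with
  | zero => simp [mpvPartial_cons_zero]
  | succ m ih =>
    simp only [mpvPartial_cons_succ one_pos, mpvPartial_cons_succ two_pos]
    have h : mpvPartial [] m = 1 := rfl
    rw [mul_pow, h]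
    linear_combination ih

theorem mpvPartial_stuffle_one_one (a b c : ℂ) (m : ℕ) :
    mpvPartial [(1, a)] m * mpvPartial [(1, b), (1, c)] m
      = mpvPartial [(1, a), (1, b), (1, c)] m + mpvPartial [(1, b), (1, a), (1, c)] m
        + mpvPartial [(1, b), (1, c), (1, a)] m + mpvPartial [(2, a * b), (1, c)] m
        + mpvPartial [(1, b), (2, a * c)] m := by
  induction m with
  | zero => simp [mpvPartial_cons_zero]
  | succ m ih =>
    have h := mpvPartial_stuffle_one a c m
    simp only [mpvPartial_cons_succ one_pos, mpvPartial_cons_succ two_pos]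
    have h' : mpvPartial [] m = 1 := rfl
    rw [mul_pow, h']
    linear_combination ih + b ^ m / (m : ℂ) ^ 1 * h

/-- Partial sums of the Cauchy product of `∑ aʲ / j` with the series of partial sums `Q`. -/
noncomputable def convPartial (a : ℂ) (Q : ℕ → ℂ) (m : ℕ) : ℂ :=
  ∑ j ∈ Finset.Ico 1 m, a ^ j / (j : ℂ) * Q (m - j)

theorem convPartial_cons_succ (a : ℂ) {s : ℕ} (hs : 0 < s) (b : ℂ) (t : List (ℕ × ℂ)) (m : ℕ) :
    convPartial a (mpvPartial ((s, b) :: t)) (m + 1)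
      = convPartial a (mpvPartial ((s, b) :: t)) m
        + ∑ j ∈ Finset.Ico 1 m,
          a ^ j / (j : ℂ) * (b ^ (m - j) / ((m - j : ℕ) : ℂ) ^ s * mpvPartial t (m - j)) := by
  rcases Nat.eq_zero_or_pos m with rfl | hm
  · simp [convPartial]
  · rw [convPartial, Finset.sum_Ico_succ_top hm, Nat.add_sub_cancel_left, mpvPartial_cons_one,
      mul_zero, add_zero, convPartial, ← Finset.sum_add_distrib]
    refine Finset.sum_congr rfl fun j hj => ?_
    rw [Nat.sub_add_comm (Finset.mem_Ico.1 hj).2.le, mpvPartial_cons_succ hs, mul_add]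

/-- The partial fraction identity `1 / (j k) = (1 / j + 1 / k) / (j + k)`, summed. -/
theorem sum_partial_fractions {a b : ℂ} (ha : a ≠ 0) (hb : b ≠ 0) (R : ℕ → ℂ) (m : ℕ) :
    ∑ j ∈ Finset.Ico 1 m, a ^ j / (j : ℂ) * (b ^ (m - j) / ((m - j : ℕ) : ℂ) ^ 1 * R (m - j))
      = a ^ m / m * ∑ k ∈ Finset.Ico 1 m, (b / a) ^ k / (k : ℂ) ^ 1 * R k
        + b ^ m / m * convPartial (a / b) R m := by
  have h := Finset.sum_Ico_reflect
    (fun j => a ^ m / m * ((b / a) ^ j / (j : ℂ) ^ 1 * R j)) 1 (Nat.le_succ m)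
  simp only [Nat.add_sub_cancel_left, Nat.add_sub_cancel] at h
  rw [Finset.mul_sum, ← h, convPartial, Finset.mul_sum, ← Finset.sum_add_distrib]
  refine Finset.sum_congr rfl fun j hj => ?_
  obtain ⟨hj1, hjm⟩ := Finset.mem_Ico.1 hj
  obtain ⟨k, rfl⟩ := Nat.exists_eq_add_of_lt hjm
  have hj0 : (j : ℂ) ≠ 0 := by exact_mod_cast (by omega : j ≠ 0)
  have hk0 : (k : ℂ) + 1 ≠ 0 := by exact_mod_cast k.succ_ne_zero
  have hjk : (j : ℂ) + k + 1 ≠ 0 := by exact_mod_cast (j + k).succ_ne_zero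
  rw [show j + k + 1 - j = k + 1 by omega]
  push_cast
  rw [div_pow, div_pow, show j + k + 1 = j + (k + 1) by omega, pow_add, pow_add]
  field_simp
  ring

theorem convPartial_one (a : ℂ) (m : ℕ) :
    convPartial a (mpvPartial []) m = mpvPartial [(1, a)] m := by
  simp [convPartial, mpvPartial]

theorem convPartial_shuffle_one {a b : ℂ} (ha : a ≠ 0) (hb : b ≠ 0) (m : ℕ) :
    convPartial a (mpvPartial [(1, b)]) m
      = mpvPartial [(1, a), (1, b / a)] m + mpvPartial [(1, b), (1, a / b)] m := by
  induction m with
  | zero => simp [mpvPartial_cons_zero, convPartial]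
  | succ m ih =>
    rw [convPartial_cons_succ a one_pos, ih, sum_partial_fractions ha hb, convPartial_one,
      mpvPartial_cons_succ one_pos a, mpvPartial_cons_succ one_pos b, pow_one,
      mpvPartial.eq_2 m 1 (b / a)]
    ring

theorem convPartial_shuffle_two {a b : ℂ} (ha : a ≠ 0) (hb : b ≠ 0) (m : ℕ) :
    convPartial a (mpvPartial [(2, b)]) m
      = mpvPartial [(1, a), (2, b / a)] m + mpvPartial [(2, a), (1, b / a)] m
        + mpvPartial [(2, b), (1, a / b)] m := by
  induction m with
  | zero => simp [mpvPartial_cons_zero, convPartial]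
  | succ m ih =>
    have h1 := sum_partial_fractions ha hb (fun k => 1 / (k : ℂ)) m
    have h2 := sum_partial_fractions (div_ne_zero ha hb) one_ne_zero (mpvPartial []) m
    have e1 : convPartial (a / b) (fun k => 1 / (k : ℂ)) m
        = ∑ j ∈ Finset.Ico 1 m, (a / b) ^ j / (j : ℂ)
          * (1 ^ (m - j) / ((m - j : ℕ) : ℂ) ^ 1 * mpvPartial [] (m - j)) := by
      simp [convPartial, mpvPartial]
    have e2 : ∀ b : ℂ, ∀ k : ℕ, b ^ k / (k : ℂ) ^ 1 * (1 / (k : ℂ))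
        = b ^ k / (k : ℂ) ^ 2 * mpvPartial [] k := fun b k => by
      rw [mpvPartial, mul_one, div_mul_div_comm, mul_one, pow_one, sq]
    rw [e1, h2] at h1
    simp only [e2, one_div_div, convPartial_one, ← mpvPartial.eq_2, div_one, one_pow] at h1
    have h3 : b ^ m * (a ^ m / b ^ m) = a ^ m := mul_div_cancel₀ _ (pow_ne_zero m hb)
    rw [convPartial_cons_succ a two_pos, ih, h1, mpvPartial_cons_succ one_pos a,
      mpvPartial_cons_succ two_pos a, mpvPartial_cons_succ two_pos b, div_pow]
    linear_combination mpvPartial [(1, b / a)] m / (m : ℂ) ^ 2 * h3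

theorem convPartial_shuffle_one_one {a b : ℂ} (ha : a ≠ 0) (hb : b ≠ 0) {c : ℂ} (hc : c ≠ 0)
    (m : ℕ) :
    convPartial a (mpvPartial [(1, b), (1, c)]) m
      = mpvPartial [(1, a), (1, b / a), (1, c)] m
        + mpvPartial [(1, b), (1, a / b), (1, b * c / a)] m
        + mpvPartial [(1, b), (1, c), (1, a / (b * c))] m := by
  induction m with
  | zero => simp [mpvPartial_cons_zero, convPartial]
  | succ m ih =>
    rw [convPartial_cons_succ a one_pos, ih, sum_partial_fractions ha hb,
      convPartial_shuffle_one (div_ne_zero ha hb) hc, mpvPartial_cons_succ one_pos a,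
      mpvPartial_cons_succ one_pos b, mpvPartial_cons_succ one_pos b, pow_one,
      mpvPartial.eq_2 m 1 (b / a), div_div, div_div_eq_mul_div, mul_comm c b]
    ring

theorem tendsto_mul_sub_convPartial {a : ℂ} (ha : ‖a‖ = 1) {Q : ℕ → ℂ}
    (hQ : ConvergesAtSqrtRate Q) :
    Tendsto (fun m => mpvPartial [(1, a)] m * Q m - convPartial a Q m) atTop (𝓝 0) := by
  obtain ⟨L, C, hC⟩ := hQ
  have hC0 : 0 ≤ C := by simpa using (norm_nonneg _).trans (hC 1 le_rfl)
  have bound : ∀ m : ℕ, 1 ≤ m → ‖mpvPartial [(1, a)] m * Q m - convPartial a Q m‖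
      ≤ 4 * C * ((1 + Real.log m) / √m) := by
    intro m hm
    have hm0 : (0 : ℝ) < m := by exact_mod_cast hm
    have hH : ∑ j ∈ Finset.Ico 1 m, 1 / (j : ℝ) ≤ 1 + Real.log m := by
      refine le_trans ?_ (harmonic_le_one_add_log m)
      rw [harmonic_eq_sum_Icc]
      push_cast
      simp only [one_div]
      exact Finset.sum_le_sum_of_subset_of_nonneg
        (Finset.Ico_subset_Icc_self) fun _ _ _ => by positivity
    have hH' : ∑ j ∈ Finset.Ico 1 m, 1 / ((m - j : ℕ) : ℝ) ≤ 1 + Real.log m := by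
      have h := Finset.sum_Ico_reflect (fun j => 1 / (j : ℝ)) 1 (Nat.le_succ m)
      simp only [Nat.add_sub_cancel_left, Nat.add_sub_cancel] at h
      exact h.trans_le hH
    rw [mpvPartial, convPartial, Finset.sum_mul, ← Finset.sum_sub_distrib]
    calc _ ≤ ∑ j ∈ Finset.Ico 1 m,
          2 * C / √m * (1 / (j : ℝ) + 1 / ((m - j : ℕ) : ℝ)) := by
          refine norm_sum_le_of_le _ fun j hj => ?_
          obtain ⟨hj1, hjm⟩ := Finset.mem_Ico.1 hj
          have hk1 : 1 ≤ m - j := by omega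
          have hj0 : (0 : ℝ) < j := by exact_mod_cast hj1
          have hk0 : (0 : ℝ) < (m - j : ℕ) := by exact_mod_cast hk1
          have hs : (m : ℝ) = j + (m - j : ℕ) := by
            rw [← Nat.cast_add, Nat.add_sub_cancel' hjm.le]
          have h1 : ‖Q m - Q (m - j)‖ ≤ 2 * C / √((m - j : ℕ) : ℝ) := by
            have h2 : C / √(m : ℝ) ≤ C / √((m - j : ℕ) : ℝ) := by
              gcongr
              omega
            calc _ = ‖(Q m - L) - (Q (m - j) - L)‖ := by congr 1; ring
              _ ≤ C / √(m : ℝ) + C / √((m - j : ℕ) : ℝ) :=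
                (norm_sub_le _ _).trans (add_le_add (hC m hm) (hC _ hk1))
              _ ≤ C / √((m - j : ℕ) : ℝ) + C / √((m - j : ℕ) : ℝ) := by gcongr
              _ = _ := by ring
          have h3 : ‖a ^ j / (j : ℂ)‖ = 1 / j := by
            rw [norm_div, norm_pow, ha, one_pow, Complex.norm_natCast]
          calc _ = ‖a ^ j / (j : ℂ)‖ * ‖Q m - Q (m - j)‖ := by
                rw [← norm_mul]
                congr 1
                simp only [mpvPartial]
                ring
            _ ≤ 1 / j * (2 * C / √((m - j : ℕ) : ℝ)) := by rw [h3]; gcongr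
            _ = 2 * C * (√((m - j : ℕ) : ℝ) / (j * (m - j : ℕ))) := by
                rw [← div_div, div_right_comm, Real.sqrt_div_self']
                field_simp
            _ ≤ 2 * C * (√(m : ℝ) / (j * (m - j : ℕ))) := by
                gcongr
                omega
            _ = 2 * C * (√(m : ℝ) / m * (1 / (j : ℝ) + 1 / ((m - j : ℕ) : ℝ))) := by
                congr 1
                have : (1 / (j : ℝ) + 1 / ((m - j : ℕ) : ℝ)) = m / (j * (m - j : ℕ)) := by
                  rw [hs]
                  field_simp
                  ring
                rw [this]
                field_simp
            _ = _ := by rw [Real.sqrt_div_self']; ring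
      _ = 2 * C / √m * (∑ j ∈ Finset.Ico 1 m, 1 / (j : ℝ)
            + ∑ j ∈ Finset.Ico 1 m, 1 / ((m - j : ℕ) : ℝ)) := by
          rw [← Finset.mul_sum, Finset.sum_add_distrib]
      _ ≤ 2 * C / √m * ((1 + Real.log m) + (1 + Real.log m)) := by gcongr
      _ = _ := by ring
  have hlim : Tendsto (fun x : ℝ => 4 * C * ((1 + Real.log x) / √x)) atTop (𝓝 0) := by
    have h1 : Tendsto (fun x : ℝ => 1 / √x) atTop (𝓝 0) :=
      tendsto_const_nhds.div_atTop Real.tendsto_sqrt_atTop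
    have h2 : Tendsto (fun x : ℝ => Real.log x / √x) atTop (𝓝 0) := by
      simpa only [Real.sqrt_eq_rpow] using
        (isLittleO_log_rpow_atTop (one_half_pos (α := ℝ))).tendsto_div_nhds_zero
    simpa [add_div] using (h1.add h2).const_mul (4 * C)
  exact squeeze_zero_norm' ((eventually_ge_atTop 1).mono bound)
    (hlim.comp tendsto_natCast_atTop_atTop)

theorem tendsto_mpvPartial_sub {x : ℂ} {t t' : List (ℕ × ℂ)} (hx : ‖x‖ = 1)
    (ht : ∀ q ∈ t, 0 < q.1 ∧ ‖q.2‖ = 1) (ht' : ∀ q ∈ t', 0 < q.1 ∧ ‖q.2‖ = 1)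
    (h1 : x = 1 → t = t') :
    Tendsto (fun m => mpvPartial ((1, x) :: t) m - mpvPartial ((1, x) :: t') m) atTop
      (𝓝 (Li ((1, x) :: t) - Li ((1, x) :: t'))) := by
  by_cases hx1 : x = 1
  · simp [h1 hx1]
  · exact (tendsto_mpvPartial_Li one_pos hx ht (.inr hx1)).sub
      (tendsto_mpvPartial_Li one_pos hx ht' (.inr hx1))

/-- The regularized double shuffle relation for `Li₁(a) · Li₂(b)`. For `a = 1` the divergent
terms on both sides are equal. -/
theorem Li_double_shuffle_two {a b : ℂ} (ha : ‖a‖ = 1) (hb : ‖b‖ = 1) :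
    Li [(1, a), (2, b)] + Li [(2, b), (1, a)] + Li [(3, a * b)]
      = Li [(1, a), (2, b / a)] + Li [(2, a), (1, b / a)] + Li [(2, b), (1, a / b)] := by
  have ha0 : a ≠ 0 := norm_ne_zero_iff.1 (by simp [ha])
  have hb0 : b ≠ 0 := norm_ne_zero_iff.1 (by simp [hb])
  have h := tendsto_mul_sub_convPartial ha
    (convergesAtSqrtRate_mpvPartial (t := []) two_pos hb (by simp) (.inl le_rfl))
  simp only [mpvPartial_stuffle_two, convPartial_shuffle_two ha0 hb0] at h
  have d := tendsto_mpvPartial_sub (t := [(2, b)]) (t' := [(2, b / a)]) ha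
    (by simp [hb]) (by simp [ha, hb]) (fun h => by simp [h])
  have l1 := tendsto_mpvPartial_Li (t := [(1, a)]) two_pos hb (by simp [ha]) (.inl le_rfl)
  have l2 := tendsto_mpvPartial_Li (z := a * b) (t := []) three_pos (by simp [ha, hb]) (by simp)
    (.inl (by norm_num))
  have l3 := tendsto_mpvPartial_Li (t := [(1, b / a)]) two_pos ha (by simp [ha, hb])
    (.inl le_rfl)
  have l4 := tendsto_mpvPartial_Li (t := [(1, a / b)]) two_pos hb (by simp [ha, hb])
    (.inl le_rfl)
  have := tendsto_nhds_unique (((((d.add l1).add l2).sub l3).sub l4).congr fun m => by ring) h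
  linear_combination this

/-- The regularized double shuffle relation for `Li₁(a) · Li₁,₁(b, c)`. For `a = 1` the
divergent terms on both sides are equal. -/
theorem Li_double_shuffle_one_one {a b c : ℂ} (ha : ‖a‖ = 1) (hb : ‖b‖ = 1) (hc : ‖c‖ = 1)
    (hb1 : b ≠ 1) :
    Li [(1, a), (1, b), (1, c)] + Li [(1, b), (1, a), (1, c)] + Li [(1, b), (1, c), (1, a)]
        + Li [(2, a * b), (1, c)] + Li [(1, b), (2, a * c)]
      = Li [(1, a), (1, b / a), (1, c)] + Li [(1, b), (1, a / b), (1, b * c / a)]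
        + Li [(1, b), (1, c), (1, a / (b * c))] := by
  have ha0 : a ≠ 0 := norm_ne_zero_iff.1 (by simp [ha])
  have hb0 : b ≠ 0 := norm_ne_zero_iff.1 (by simp [hb])
  have hc0 : c ≠ 0 := norm_ne_zero_iff.1 (by simp [hc])
  have h := tendsto_mul_sub_convPartial ha
    (convergesAtSqrtRate_mpvPartial (t := [(1, c)]) one_pos hb (by simp [hc]) (.inr hb1))
  simp only [mpvPartial_stuffle_one_one, convPartial_shuffle_one_one ha0 hb0 hc0] at h
  have d := tendsto_mpvPartial_sub (t := [(1, b), (1, c)]) (t' := [(1, b / a), (1, c)]) ha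
    (by simp [hb, hc]) (by simp [ha, hb, hc]) (fun h => by simp [h])
  have l (t : List (ℕ × ℂ)) (ht : ∀ q ∈ t, 0 < q.1 ∧ ‖q.2‖ = 1) :=
    tendsto_mpvPartial_Li one_pos hb ht (.inr hb1)
  have l1 := l [(1, a), (1, c)] (by simp [ha, hc])
  have l2 := l [(1, c), (1, a)] (by simp [ha, hc])
  have l3 := tendsto_mpvPartial_Li (z := a * b) (t := [(1, c)]) two_pos (by simp [ha, hb])
    (by simp [hc]) (.inl le_rfl)
  have l4 := l [(2, a * c)] (by simp [ha, hc])
  have l5 := l [(1, a / b), (1, b * c / a)] (by simp [ha, hb, hc])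
  have l6 := l [(1, c), (1, a / (b * c))] (by simp [ha, hb, hc])
  have := tendsto_nhds_unique
    (((((((d.add l1).add l2).add l3).add l4).sub l5).sub l6).congr fun m => by ring) h
  linear_combination this

theorem Li_stuffle_two {a b : ℂ} (ha : ‖a‖ = 1) (hb : ‖b‖ = 1) (ha1 : a ≠ 1) :
    Li [(1, a)] * Li [(2, b)]
      = Li [(1, a), (2, b)] + Li [(2, b), (1, a)] + Li [(3, a * b)] := by
  have l0 := tendsto_mpvPartial_Li (t := []) one_pos ha (by simp) (.inr ha1)
  have l1 := tendsto_mpvPartial_Li (t := []) two_pos hb (by simp) (.inl le_rfl)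
  have l2 := tendsto_mpvPartial_Li (t := [(2, b)]) one_pos ha (by simp [hb]) (.inr ha1)
  have l3 := tendsto_mpvPartial_Li (t := [(1, a)]) two_pos hb (by simp [ha]) (.inl le_rfl)
  have l4 := tendsto_mpvPartial_Li (z := a * b) (t := []) three_pos (by simp [ha, hb]) (by simp)
    (.inl (by norm_num))
  exact tendsto_nhds_unique (l0.mul l1)
    (((l2.add l3).add l4).congr fun m => (mpvPartial_stuffle_two a b m).symm)

theorem Li_stuffle_one_one {a b c : ℂ} (ha : ‖a‖ = 1) (hb : ‖b‖ = 1) (hc : ‖c‖ = 1)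
    (ha1 : a ≠ 1) (hb1 : b ≠ 1) :
    Li [(1, a)] * Li [(1, b), (1, c)]
      = Li [(1, a), (1, b), (1, c)] + Li [(1, b), (1, a), (1, c)]
        + Li [(1, b), (1, c), (1, a)] + Li [(2, a * b), (1, c)] + Li [(1, b), (2, a * c)] := by
  have l0 := tendsto_mpvPartial_Li (t := []) one_pos ha (by simp) (.inr ha1)
  have l (t : List (ℕ × ℂ)) (ht : ∀ q ∈ t, 0 < q.1 ∧ ‖q.2‖ = 1) :=
    tendsto_mpvPartial_Li one_pos hb ht (.inr hb1)
  have l1 := l [(1, c)] (by simp [hc])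
  have l2 := tendsto_mpvPartial_Li (t := [(1, b), (1, c)]) one_pos ha (by simp [hb, hc])
    (.inr ha1)
  have l3 := l [(1, a), (1, c)] (by simp [ha, hc])
  have l4 := l [(1, c), (1, a)] (by simp [ha, hc])
  have l5 := tendsto_mpvPartial_Li (z := a * b) (t := [(1, c)]) two_pos (by simp [ha, hb])
    (by simp [hc]) (.inl le_rfl)
  have l6 := l [(2, a * c)] (by simp [ha, hc])
  exact tendsto_nhds_unique (l0.mul l1) (((((l2.add l3).add l4).add l5).add l6).congr fun m =>
    (mpvPartial_stuffle_one_one a b c m).symm)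

/-- The distribution relation `Li₁(z) + Li₁(-z) = Li₁(z²)`. -/
theorem Li_one_add_Li_one_neg {z : ℂ} (hz : ‖z‖ = 1) (hz1 : z ^ 2 ≠ 1) :
    Li [(1, z)] + Li [(1, -z)] = Li [(1, z ^ 2)] := by
  have l1 := tendsto_mpvPartial_Li (z := z) (t := []) one_pos hz (by simp)
    (.inr fun h => hz1 (by simp [h]))
  have l2 := tendsto_mpvPartial_Li (z := -z) (t := []) one_pos (by simpa using hz) (by simp)
    (.inr fun h => hz1 (by rw [← neg_sq, h, one_pow]))
  have l3 := tendsto_mpvPartial_Li (z := z ^ 2) (t := []) one_pos (by simp [hz]) (by simp)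
    (.inr hz1)
  refine tendsto_nhds_unique (((l1.add l2).comp (tendsto_id.const_mul_atTop' two_pos)).congr
    fun m => ?_) l3
  simp only [Function.comp_apply, id_eq]
  induction m with
  | zero => simp [mpvPartial_cons_zero]
  | succ m ih =>
    rw [show 2 * (m + 1) = 2 * m + 1 + 1 by ring, mpvPartial_cons_succ one_pos (z ^ 2), ← ih]
    simp only [mpvPartial_cons_succ one_pos, (even_two_mul m).neg_pow,
      (even_two_mul m).add_one.neg_pow, pow_one, ← pow_mul]
    push_cast
    simp only [mpvPartial]
    ring

/-! ### Linear algebra of the weight three relations at level four -/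

set_option linter.unusedSimpArgs false in
/-- The double shuffle and distribution relations in weight three and level four determine all
values from the nine in the hypotheses. Here `A a`, `B a b`, `C a b`, `T a b c` stand for the
values with exponents `(3)`, `(2, 1)`, `(1, 2)`, `(1, 1, 1)` at powers of `i`. -/
theorem eq_zero_of_level_four_relations {A : Fin 4 → ℚ} {B C : Fin 4 → Fin 4 → ℚ}
    {T : Fin 4 → Fin 4 → Fin 4 → ℚ}
    (h2 : ∀ a b, C a b + B b a + A (a + b) = C a (b - a) + B a (b - a) + B b (a - b))
    (h3 : ∀ a b c, b ≠ 0 → T a b c + T b a c + T b c a + B (a + b) c + C b (a + c)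
      = T a (b - a) c + T b (a - b) (b + c - a) + T b c (a - b - c))
    (d2 : ∀ b, C 1 b + B b 1 + A (1 + b) + (C 3 b + B b 3 + A (3 + b))
      = C 2 b + B b 2 + A (2 + b))
    (d3 : ∀ b c, b ≠ 0 → T 1 b c + T b 1 c + T b c 1 + B (1 + b) c + C b (1 + c)
        + (T 3 b c + T b 3 c + T b c 3 + B (3 + b) c + C b (3 + c))
      = T 2 b c + T b 2 c + T b c 2 + B (2 + b) c + C b (2 + c))
    (e1 : C 2 3 = 0) (e2 : T 1 0 0 = 0) (e3 : T 2 2 1 = 0) (e4 : T 1 1 1 = 0) (e5 : C 3 1 = 0)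
    (e6 : T 3 2 0 = 0) (e7 : T 3 0 0 = 0) (e8 : T 1 1 2 = 0) (e9 : B 3 0 = 0) :
    (∀ a, A a = 0) ∧ (∀ a b, B a b = 0) ∧ (∀ a b, a ≠ 0 → C a b = 0) ∧
      ∀ a b c, a ≠ 0 → T a b c = 0 := by
  have e_T220 : T 2 2 0 = T 2 0 2 + C 2 2 + B 2 2 := by
    linear_combination (norm := (simp only [Fin.isValue, Fin.reduceAdd, Fin.reduceSub]; ring1))
      -h3 0 2 2 (by decide)
  have e_B00 : B 0 0 = A 0 := by
    linear_combination (norm := (simp only [Fin.isValue, Fin.reduceAdd, Fin.reduceSub]; ring1))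
      -h2 0 0
  have e_T200 : T 2 0 0 = T 2 0 2 + C 2 2 + 2 / 3 * B 2 2 + 1 / 3 * A 0 := by
    linear_combination (norm := (simp only [Fin.isValue, Fin.reduceAdd, Fin.reduceSub]; ring1))
      -1 / 3 * h3 2 2 0 (by decide) + 2 / 3 * e_T220 + 1 / 3 * e_B00
  have e_T301 : T 3 0 1 = C 3 0 - T 3 1 3 := by
    linear_combination (norm := (simp only [Fin.isValue, Fin.reduceAdd, Fin.reduceSub]; ring1))
      -h3 0 3 0 (by decide) + 2 * e7 + e9
  have e_T202 : T 2 0 2 = T 2 2 2 + 1 / 2 * C 2 0 + 1 / 2 * B 0 2 := by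
    linear_combination (norm := (simp only [Fin.isValue, Fin.reduceAdd, Fin.reduceSub]; ring1))
      -1 / 2 * h3 2 2 2 (by decide)
  have e_T103 : T 1 0 3 = T 1 3 0 - C 1 3 - B 1 3 := by
    linear_combination (norm := (simp only [Fin.isValue, Fin.reduceAdd, Fin.reduceSub]; ring1))
      h3 0 1 3 (by decide)
  have e_T101 : T 1 0 1 = -2 * T 1 1 0 - C 1 1 - B 2 0 := by
    linear_combination (norm := (simp only [Fin.isValue, Fin.reduceAdd, Fin.reduceSub]; ring1))
      h3 1 1 0 (by decide) + 3 * e2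
  have e_T310 : T 3 1 0 = B 3 1 + C 3 0 - T 3 1 3 := by
    linear_combination (norm := (simp only [Fin.isValue, Fin.reduceAdd, Fin.reduceSub]; ring1))
      -h3 0 3 1 (by decide) + e5 + e_T301
  have e_T203 : T 2 0 3 = -T 2 3 0 - B 2 3 + T 2 3 3 := by
    linear_combination (norm := (simp only [Fin.isValue, Fin.reduceAdd, Fin.reduceSub]; ring1))
      h3 0 2 3 (by decide) - e1 + e3
  have e_T110 : T 1 1 0 = B 1 1 - T 1 3 2 - B 2 0 := by
    linear_combination (norm := (simp only [Fin.isValue, Fin.reduceAdd, Fin.reduceSub]; ring1))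
      -h3 0 1 1 (by decide) - e8 + e_T101
  have e_A3 : A 3 = -C 3 0 + B 3 1 := by
    linear_combination (norm := (simp only [Fin.isValue, Fin.reduceAdd, Fin.reduceSub]; ring1))
      h2 3 0 + e5
  have e_B03 : B 0 3 = -C 3 0 := by
    linear_combination (norm := (simp only [Fin.isValue, Fin.reduceAdd, Fin.reduceSub]; ring1))
      -h2 0 3 + e9 + e_A3
  have e_T303 : T 3 0 3 = -2 * T 3 3 0 - C 3 3 - B 2 0 := by
    linear_combination (norm := (simp only [Fin.isValue, Fin.reduceAdd, Fin.reduceSub]; ring1))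
      h3 3 3 0 (by decide) + 3 * e7
  have e_T222 : T 2 2 2 = 1 / 3 * T 1 2 2 + 1 / 3 * T 2 1 2 + 1 / 3 * B 3 2 + 1 / 3 * T 3 2 2 +
      1 / 3 * T 2 3 2 + 1 / 3 * T 2 2 3 + 1 / 3 * C 2 1 + 1 / 3 * B 1 2 - 1 / 3 * C 2 0 -
      1 / 3 * B 0 2 := by
    linear_combination (norm := (simp only [Fin.isValue, Fin.reduceAdd, Fin.reduceSub]; ring1))
      -1 / 3 * d3 2 2 (by decide) + 1 / 3 * e3 + 1 / 3 * e1
  have e_T223 : T 2 2 3 = T 2 0 1 + T 2 1 0 + C 2 1 + B 2 1 - T 2 1 1 := by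
    linear_combination (norm := (simp only [Fin.isValue, Fin.reduceAdd, Fin.reduceSub]; ring1))
      -h3 0 2 1 (by decide)
  have e_T201 : T 2 0 1 = 1 / 2 * T 2 1 2 + 1 / 2 * B 0 1 - 1 / 2 * T 2 1 3 := by
    linear_combination (norm := (simp only [Fin.isValue, Fin.reduceAdd, Fin.reduceSub]; ring1))
      -1 / 2 * h3 2 2 1 (by decide) + e3 + 1 / 2 * e1
  have e_T302 : T 3 0 2 = -C 3 2 - B 3 2 + T 3 1 1 + T 3 2 3 := by
    linear_combination (norm := (simp only [Fin.isValue, Fin.reduceAdd, Fin.reduceSub]; ring1))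
      h3 0 3 2 (by decide) - e6
  have e_T330 : T 3 3 0 = B 3 3 - T 3 1 2 - T 3 3 2 - B 2 0 := by
    linear_combination (norm := (simp only [Fin.isValue, Fin.reduceAdd, Fin.reduceSub]; ring1))
      -h3 0 3 3 (by decide) + e_T303
  have e_A2 : A 2 = -C 3 3 - B 3 3 + C 3 0 := by
    linear_combination (norm := (simp only [Fin.isValue, Fin.reduceAdd, Fin.reduceSub]; ring1))
      h2 3 3 + 2 * e9
  have e_A1 : A 1 = -B 1 0 + B 0 1 + B 1 3 := by
    linear_combination (norm := (simp only [Fin.isValue, Fin.reduceAdd, Fin.reduceSub]; ring1))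
      h2 0 1
  have e_T122 : T 1 2 2 = -T 2 1 2 - B 3 2 + T 2 3 3 := by
    linear_combination (norm := (simp only [Fin.isValue, Fin.reduceAdd, Fin.reduceSub]; ring1))
      h3 1 2 2 (by decide) - e1 + e8
  have e_T133 : T 1 3 3 = -T 3 1 3 - C 1 2 + T 3 2 3 + T 1 2 1 + C 3 0 := by
    linear_combination (norm := (simp only [Fin.isValue, Fin.reduceAdd, Fin.reduceSub]; ring1))
      h3 3 1 3 (by decide) - e_B03
  have e_T331 : T 3 3 1 = 1 / 2 * C 3 0 - 1 / 2 * B 2 1 - T 3 1 3 := by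
    linear_combination (norm := (simp only [Fin.isValue, Fin.reduceAdd, Fin.reduceSub]; ring1))
      1 / 2 * h3 3 3 1 (by decide) + e_T301
  have e_C13 : C 1 3 = C 1 0 - B 1 0 + B 0 1 := by
    linear_combination (norm := (simp only [Fin.isValue, Fin.reduceAdd, Fin.reduceSub]; ring1))
      -h2 1 0 + e_A1
  have e_T131 : T 1 3 1 = 2 * C 1 0 - T 1 3 0 + B 1 3 + B 0 1 := by
    linear_combination (norm := (simp only [Fin.isValue, Fin.reduceAdd, Fin.reduceSub]; ring1))
      -h3 0 1 0 (by decide) + 2 * e2 - e_T103 + e_C13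
  have e_T333 : T 3 3 3 = T 3 2 3 + 2 * T 2 3 3 + C 2 2 + B 1 3 - T 2 1 2 - T 2 3 2 := by
    linear_combination (norm := (simp only [Fin.isValue, Fin.reduceAdd, Fin.reduceSub]; ring1))
      -h3 3 2 3 (by decide)
  have e_T102 : T 1 0 2 = -T 1 2 0 - 2 * C 1 2 - B 1 2 + 2 * T 1 2 1 - T 3 1 3 + T 3 2 3 + C 3 0
      := by
    linear_combination (norm := (simp only [Fin.isValue, Fin.reduceAdd, Fin.reduceSub]; ring1))
      h3 0 1 2 (by decide) + e_T133
  have e_T322 : T 3 2 2 = -T 2 3 2 - C 2 1 - B 1 2 + T 3 3 2 + T 2 1 1 := by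
    linear_combination (norm := (simp only [Fin.isValue, Fin.reduceAdd, Fin.reduceSub]; ring1))
      h3 3 2 2 (by decide)
  have e_T123 : T 1 2 3 = -T 2 1 3 - C 1 1 - B 3 3 + T 2 3 3 := by
    linear_combination (norm := (simp only [Fin.isValue, Fin.reduceAdd, Fin.reduceSub]; ring1))
      h3 2 1 3 (by decide) + e8
  have e_T230 : T 2 3 0 = 1 / 2 * T 2 3 1 + 1 / 2 * C 2 0 - 1 / 2 * T 1 1 3 - 1 / 2 * C 1 1 +
      1 / 2 * T 2 3 3 := by
    linear_combination (norm := (simp only [Fin.isValue, Fin.reduceAdd, Fin.reduceSub]; ring1))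
      -1 / 2 * h3 1 2 3 (by decide) + 1 / 2 * e_T123
  have e_C32 : C 3 2 = B 1 3 + A 0 - B 3 2 - B 1 2 := by
    linear_combination (norm := (simp only [Fin.isValue, Fin.reduceAdd, Fin.reduceSub]; ring1))
      -h2 3 1 + e5
  have e_B02 : B 0 2 = B 2 0 - B 2 2 - C 3 3 - B 3 3 + C 3 0 := by
    linear_combination (norm := (simp only [Fin.isValue, Fin.reduceAdd, Fin.reduceSub]; ring1))
      -h2 0 2 + e_A2
  have e_B22 : B 2 2 = -C 2 2 - A 0 + C 2 0 + 2 * B 2 0 := by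
    linear_combination (norm := (simp only [Fin.isValue, Fin.reduceAdd, Fin.reduceSub]; ring1))
      h2 2 2
  have e_T321 : T 3 2 1 = -T 2 3 1 - C 3 3 - B 1 1 + T 2 1 1 + T 3 3 2 := by
    linear_combination (norm := (simp only [Fin.isValue, Fin.reduceAdd, Fin.reduceSub]; ring1))
      h3 2 3 1 (by decide)
  have e_T210 : T 2 1 0 = 2 * T 1 3 0 + C 1 2 + A 0 - B 1 3 + B 3 1 + B 1 2 - 2 * T 1 2 1 -
      T 3 2 3 := by
    linear_combination (norm := (simp only [Fin.isValue, Fin.reduceAdd, Fin.reduceSub]; ring1))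
      -d3 1 0 (by decide) - e9 + e_B00 + e_T103 + e_T101 + e_T310 - e_T102
  have e_C21 : C 2 1 = -B 1 2 + B 2 3 + B 1 1 + C 3 0 - B 3 1 := by
    linear_combination (norm := (simp only [Fin.isValue, Fin.reduceAdd, Fin.reduceSub]; ring1))
      h2 2 1 + e1 - e_A3
  have e_T232 : T 2 3 2 = T 1 2 1 + 2 * T 2 1 1 + C 2 2 + B 3 1 - T 2 1 2 := by
    linear_combination (norm := (simp only [Fin.isValue, Fin.reduceAdd, Fin.reduceSub]; ring1))
      -h3 1 2 1 (by decide) - e4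
  have e_T132 : T 1 3 2 = 1 / 4 * C 1 2 + 1 / 4 * B 2 1 - 1 / 4 * T 1 1 3 + 1 / 2 * C 1 1 -
      1 / 2 * B 2 0 + B 1 1 := by
    linear_combination (norm := (simp only [Fin.isValue, Fin.reduceAdd, Fin.reduceSub]; ring1))
      -1 / 4 * h3 1 1 1 (by decide) + 3 / 4 * e4 - 1 / 2 * e_T101 + e_T110
  have e_T120 : T 1 2 0 = -B 1 0 + 3 / 2 * C 2 2 - 1 / 2 * A 0 + 2 * C 2 0 + B 2 3 + B 2 1 +
      T 3 3 2 + 7 / 2 * B 2 0 - 1 / 2 * C 3 3 - 1 / 2 * B 3 3 + 1 / 2 * C 3 0 := by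
    linear_combination (norm := (simp only [Fin.isValue, Fin.reduceAdd, Fin.reduceSub]; ring1))
      d3 2 0 (by decide) - e9 - e6 - e1 + 2 * e_T220 + e_B00 + 3 * e_T202 - e_T203 + 3 * e_T222 +
          e_T223 + e_T122 + e_T322 + 1 / 2 * e_B02 + 3 / 2 * e_B22
  have e_T312 : T 3 1 2 = -1 / 2 * T 2 3 3 - 1 / 2 * T 3 2 3 - 3 / 2 * T 3 3 2 - 1 / 2 * B 1 3 +
      1 / 2 * T 2 1 3 + B 3 3 - B 2 0 := by
    linear_combination (norm := (simp only [Fin.isValue, Fin.reduceAdd, Fin.reduceSub]; ring1))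
      1 / 2 * h3 2 3 3 (by decide) - 1 / 2 * e5 + e_T330
  have e_B33 : B 3 3 = -C 3 3 + C 3 0 + A 0 - 2 * B 2 0 := by
    linear_combination (norm := (simp only [Fin.isValue, Fin.reduceAdd, Fin.reduceSub]; ring1))
      -h2 2 0 + e_A2 - e_B22
  have e_C22 : C 2 2 = -2 * C 2 0 - 25 / 7 * B 2 0 + 4 / 7 * A 0 := by
    linear_combination (norm := (simp only [Fin.isValue, Fin.reduceAdd, Fin.reduceSub]; ring1))
      6 / 7 * h3 0 2 0 (by decide) - 12 / 7 * e_T200 - 6 / 7 * e_T202 - 3 / 7 * e_B02 -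
          5 / 7 * e_B22 + 3 / 7 * e_B33
  have e_C11 : C 1 1 = -B 1 3 + B 2 3 - 2 * B 2 0 := by
    linear_combination (norm := (simp only [Fin.isValue, Fin.reduceAdd, Fin.reduceSub]; ring1))
      d2 1 - e5 + e_A3 - e_A2 + e_C21 + e_B33
  have e_C10 : C 1 0 = B 1 1 - 2 * B 1 0 - A 0 - B 1 3 + B 2 3 := by
    linear_combination (norm := (simp only [Fin.isValue, Fin.reduceAdd, Fin.reduceSub]; ring1))
      -h2 1 1 + e_A2 - e_B33 + e_C11
  have e_T311 : T 3 1 1 = -2 * B 0 1 + T 1 2 1 + T 3 2 3 + T 1 3 0 + A 0 + B 3 2 + B 1 2 -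
      2 * B 1 1 + 4 * B 1 0 - 2 * B 2 3 := by
    linear_combination (norm := (simp only [Fin.isValue, Fin.reduceAdd, Fin.reduceSub]; ring1))
      h3 1 3 1 (by decide) - e_T131 - e_C32 - 2 * e_C10
  have e_T212 : T 2 1 2 = 2 * B 1 0 - 2 * B 2 3 + T 2 3 3 - B 0 1 - T 3 3 2 - T 3 2 3 - B 1 3 :=
      by
    linear_combination (norm := (simp only [Fin.isValue, Fin.reduceAdd, Fin.reduceSub]; ring1))
      -2 * h3 3 2 0 (by decide) + 2 * e6 + 2 * e1 + 2 * e_T203 - 2 * e_T201 - 2 * e_T330 +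
          2 * e_T312
  have e_T130 : T 1 3 0 = T 1 1 3 + 2 * B 2 3 - 1 / 2 * B 1 3 - 4 * B 1 0 + B 0 1 + 3 / 2 * B 1 1
      - 3 / 2 * A 0 := by
    linear_combination (norm := (simp only [Fin.isValue, Fin.reduceAdd, Fin.reduceSub]; ring1))
      -1 / 2 * h3 1 1 3 (by decide) - e_T103 + e_C13 + 3 / 2 * e_C10
  have e_B32 : B 3 2 = B 3 1 + C 3 0 - 2 * B 1 3 + B 1 1 - 2 * B 1 0 + B 2 3 := by
    linear_combination (norm := (simp only [Fin.isValue, Fin.reduceAdd, Fin.reduceSub]; ring1))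
      -d2 3 - e1 + e_A2 - e_A1 + e_C13 + e_C10
  have e_C33 : C 3 3 = B 2 1 + 3 * B 1 0 - B 0 1 + B 1 3 - B 1 2 + C 3 0 - 2 * B 3 1 + A 0 -
      2 * B 2 0 := by
    linear_combination (norm := (simp only [Fin.isValue, Fin.reduceAdd, Fin.reduceSub]; ring1))
      h2 2 3 - e1 - e_A1 + e_C21 + e_B33 - e_B32
  have e_B12 : B 1 2 = -C 1 2 - B 1 0 + B 0 1 + B 1 3 - C 3 0 := by
    linear_combination (norm := (simp only [Fin.isValue, Fin.reduceAdd, Fin.reduceSub]; ring1))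
      -h2 1 3 + e_C13 + e_C10 - e_B32
  have e_T211 : T 2 1 1 = B 2 1 + T 1 1 3 - 2 * B 1 0 - 2 * B 1 3 - A 0 + T 3 2 3 + B 1 1 + B 2 3
      := by
    linear_combination (norm := (simp only [Fin.isValue, Fin.reduceAdd, Fin.reduceSub]; ring1))
      -d3 1 1 (by decide) + 3 * e4 - e8 - e_C13 + e_T131 + 2 * e_C10 + e_T311 + e_B32 + e_B12
  have e_T231 : T 2 3 1 = 2 * T 2 3 3 - T 3 3 2 + B 2 3 - 2 * C 2 0 - 11 / 7 * B 2 0 + 4 / 7 * A 0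
      - 2 * B 2 1 - B 1 0 + B 0 1 - T 1 1 3 + 2 * B 1 3 := by
    linear_combination (norm := (simp only [Fin.isValue, Fin.reduceAdd, Fin.reduceSub]; ring1))
      h3 2 3 2 (by decide) + e_T333 - 2 * e_T322 + e_T321 + 2 * e_C21 + e_C22 - e_C33 - e_T211
  have e_T313 : T 3 1 3 = 5 / 14 * A 0 + 2 * C 3 0 - 1 / 2 * T 3 3 2 + 3 / 2 * B 1 1 -
      3 / 2 * B 1 0 - 1 / 2 * C 2 0 - 19 / 14 * B 2 0 + 1 / 2 * B 0 1 + 2 * B 2 3 -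
      1 / 2 * T 2 3 3 + C 1 2 + 1 / 2 * T 1 1 3 := by
    linear_combination (norm := (simp only [Fin.isValue, Fin.reduceAdd, Fin.reduceSub]; ring1))
      -1 / 2 * h3 1 3 0 (by decide) + 1 / 2 * e5 + 1 / 2 * e_B00 + 1 / 2 * e_T301 + 1 / 2 * e_T310
          - 1 / 2 * e_T302 - 1 / 2 * e_T322 + 1 / 2 * e_C32 + 1 / 2 * e_C21 + 1 / 2 * e_T232 -
          1 / 2 * e_T120 + 1 / 4 * e_B33 - 1 / 4 * e_C22 - 1 / 2 * e_T311 - 1 / 2 * e_T212 -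
          1 / 2 * e_B32 - e_B12 + 1 / 2 * e_T211
  have e_B31 : B 3 1 = -C 1 2 - B 2 1 + B 1 1 + 2 * B 2 3 + C 3 0 - B 1 3 - 2 * B 2 0 := by
    linear_combination (norm := (simp only [Fin.isValue, Fin.reduceAdd, Fin.reduceSub]; ring1))
      h2 1 2 - e_A3 + e_C11
  have e_C30 : C 3 0 = B 1 0 + 2 * B 1 3 + 2 * B 2 0 - B 1 1 + C 1 2 - B 2 3 := by
    linear_combination (norm := (simp only [Fin.isValue, Fin.reduceAdd, Fin.reduceSub]; ring1))
      -1 / 2 * h2 3 2 + 1 / 2 * e_A1 + 1 / 2 * e_C32 - 1 / 2 * e_B33 - 1 / 2 * e_B32 -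
          1 / 2 * e_B12 - 1 / 2 * e_B31
  have e_C20 : C 2 0 = C 1 2 + B 2 1 + B 1 0 + B 1 3 + A 0 - 4 * B 2 0 + B 2 3 := by
    linear_combination (norm := (simp only [Fin.isValue, Fin.reduceAdd, Fin.reduceSub]; ring1))
      -d2 2 + e_A3 + e_A1 + e_C32 - e_B22 - e_B32 - e_B12 - e_C30
  have e_T213 : T 2 1 3 = -T 2 3 3 + T 1 2 1 - 17 / 7 * A 0 + 73 / 7 * B 2 0 - 3 * B 2 3 + B 2 1 -
      2 * B 0 1 + C 1 2 + 2 * T 1 1 3 + 2 * T 3 2 3 - 2 * B 1 3 := by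
    linear_combination (norm := (simp only [Fin.isValue, Fin.reduceAdd, Fin.reduceSub]; ring1))
      h3 2 1 2 (by decide) + e4 - 2 * e_T122 + e_T123 + e_T232 - e_B33 + e_C22 - e_C11 - e_C10 +
          e_B32 + e_C33 - e_B12 + 2 * e_T211 + 2 * e_C30 - 2 * e_C20
  have e_B01 : B 0 1 = 1 / 2 * B 1 0 + 33 / 7 * B 2 0 - 5 / 7 * A 0 - B 1 1 - 5 / 2 * B 2 3 -
      1 / 2 * C 1 2 - 1 / 2 * B 2 1 - 1 / 2 * B 1 3 := by
    linear_combination (norm := (simp only [Fin.isValue, Fin.reduceAdd, Fin.reduceSub]; ring1))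
      1 / 2 * d2 0 - 1 / 2 * e_A3 - 1 / 2 * e_B03 + 1 / 2 * e_A2 - 1 / 2 * e_A1 + 1 / 2 * e_B02 -
          1 / 2 * e_B22 - e_B33 + 1 / 2 * e_C22 - 1 / 2 * e_C10 - 1 / 2 * e_B31 - e_C20
  have e_T233 : T 2 3 3 = -33 / 14 * A 0 - 4 * B 1 3 - 2 * C 1 2 + 5 / 2 * B 2 3 - 1 / 7 * B 2 0 +
      2 * T 1 1 3 - 9 / 2 * B 1 0 + 3 / 2 * B 1 1 + T 3 3 2 := by
    linear_combination (norm := (simp only [Fin.isValue, Fin.reduceAdd, Fin.reduceSub]; ring1))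
      -h3 2 1 0 (by decide) + e9 - e_T101 + 2 * e_T110 + e_T102 - e_T230 + e_T210 - 2 * e_T132 +
          1 / 2 * e_C11 + 2 * e_T130 - 1 / 2 * e_T231 - e_T313 + e_B31 + e_C20 + e_B01
  have e_B23 : B 2 3 = 1 / 4 * T 1 1 3 + 1 / 4 * C 1 2 - 11 / 7 * A 0 - T 1 2 1 - T 3 2 3 +
      46 / 7 * B 2 0 - 5 / 2 * B 1 0 - 3 / 4 * B 2 1 := by
    linear_combination (norm := (simp only [Fin.isValue, Fin.reduceAdd, Fin.reduceSub]; ring1))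
      -1 / 4 * h3 2 2 3 (by decide) - 1 / 2 * e_T203 + 1 / 4 * e_B03 + 1 / 2 * e_T223 +
          1 / 2 * e_T201 + 1 / 2 * e_T230 + 1 / 2 * e_T210 + 3 / 4 * e_C21 + 1 / 4 * e_T232 +
          1 / 4 * e_C22 - 1 / 4 * e_C11 + e_T130 - 1 / 4 * e_B12 + 3 / 4 * e_C30 - 1 / 4 * e_C20 -
          1 / 4 * e_T213 + 3 / 2 * e_B01
  have e_B11 : B 1 1 = -5 * C 1 2 + 4 * T 3 2 3 + 4 * T 1 2 1 - B 1 3 - B 2 1 + 88 / 7 * B 2 0 -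
      6 * B 1 0 - 39 / 7 * A 0 := by
    linear_combination (norm := (simp only [Fin.isValue, Fin.reduceAdd, Fin.reduceSub]; ring1))
      -4 * d3 1 3 (by decide) + 4 * e_B03 + 8 * e_T133 + 4 * e_T131 - 4 * e_T123 - 4 * e_T132 -
          2 * e_C11 + 12 * e_C10 - 4 * e_T130 - 4 * e_T313 - 4 * e_C30 + 2 * e_C20 - 2 * e_B01 -
          2 * e_T233 + 4 * e_B23
  have e_T332 : T 3 3 2 = 25 / 3 * B 1 0 + B 2 1 - 4 / 3 * T 1 1 3 + B 1 3 + 75 / 14 * A 0 -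
      284 / 21 * B 2 0 + 2 * C 1 2 := by
    linear_combination (norm := (simp only [Fin.isValue, Fin.reduceAdd, Fin.reduceSub]; ring1))
      1 / 3 * h3 2 3 0 (by decide) - 1 / 3 * e6 + 1 / 3 * e_T303 - 1 / 3 * e_T302 - 2 / 3 * e_T330
          + 1 / 3 * e_T331 - 1 / 3 * e_T230 + 1 / 3 * e_T210 + 2 / 3 * e_T312 + 1 / 6 * e_C11 -
          1 / 3 * e_T311 + 1 / 3 * e_T130 - 1 / 3 * e_C33 + 1 / 3 * e_B12 - 1 / 6 * e_T231 -
          1 / 3 * e_T313 + e_B31 - 1 / 6 * e_C30 + 1 / 3 * e_C20 + 1 / 3 * e_T213 + 2 / 3 * e_B01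
          - e_T233 - 2 * e_B23 - 1 / 3 * e_B11
  have e_T121 : T 1 2 1 = -2 * T 3 2 3 + 34 / 21 * B 2 0 - 1 / 28 * A 0 + 1 / 12 * B 1 0 -
      11 / 24 * T 1 1 3 - 5 / 8 * B 2 1 + 3 / 8 * C 1 2 := by
    linear_combination (norm := (simp only [Fin.isValue, Fin.reduceAdd, Fin.reduceSub]; ring1))
      -d3 3 1 (by decide) + 2 * e_T331 + e_T131 + e_C32 - e_T321 - e_T312 - e_B33 + 2 * e_C10 +
          2 * e_T311 + e_T130 + e_B32 + e_C33 - e_T211 - e_T313 - e_B31 + 1 / 2 * e_C20 -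
          1 / 2 * e_T213 - 3 / 2 * e_B01 + 3 / 2 * e_T233 + 11 / 2 * e_B23 + 3 / 4 * e_B11 +
          5 / 2 * e_T332
  have e_B13 : B 1 3 = 1 / 8 * C 1 2 - 317 / 14 * B 2 0 + 3 * T 3 2 3 + 179 / 28 * A 0 -
      3 / 8 * T 1 1 3 + 33 / 4 * B 1 0 + 33 / 8 * B 2 1 := by
    linear_combination (norm := (simp only [Fin.isValue, Fin.reduceAdd, Fin.reduceSub]; ring1))
      h3 1 3 3 (by decide) - e_B03 - e_T133 - e_T331 + e_T333 + e_T123 + e_T321 - e_T232 - e_B33 -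
          e_C11 - e_T211 - e_T231 + e_T313 - e_B31 - 3 / 2 * e_C30 + 3 / 2 * e_C20 - e_T213 +
          3 / 2 * e_B01 + 3 / 2 * e_T233 + 3 * e_B23 + 3 / 4 * e_B11 + 3 * e_T332 - 3 * e_T121
  have e_T113 : T 1 1 3 = -1014 / 7 * B 2 0 + 54 * B 1 0 + 28 * B 2 1 + 300 / 7 * A 0 + 8 * C 1 2
      + 20 * T 3 2 3 := by
    linear_combination (norm := (simp only [Fin.isValue, Fin.reduceAdd, Fin.reduceSub]; ring1))
      h3 3 1 1 (by decide) + e4 - e_T131 + e_T123 + e_T321 - e_B33 - e_C11 - 3 * e_C10 - e_T311 -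
          e_B32 - e_B12 + e_T211 - e_T231 - e_B31 - 2 * e_C30 + 2 * e_C20 - e_T213 + 2 * e_B23 -
          e_B11 + 2 * e_T332 - 8 * e_T121 + 4 * e_B13
  have e_B10 : B 1 0 = -2 / 5 * T 3 2 3 + 6599 / 2380 * B 2 0 - 49 / 340 * C 1 2 - 486 / 595 * A 0
      - 37 / 68 * B 2 1 := by
    linear_combination (norm := (simp only [Fin.isValue, Fin.reduceAdd, Fin.reduceSub]; ring1))
      -3 / 85 * d3 3 0 (by decide) + 3 / 85 * e5 - 3 / 85 * e6 + 3 / 85 * e_B00 + 3 / 85 * e_T301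
          + 3 / 85 * e_T310 + 3 / 85 * e_T303 - 3 / 85 * e_T302 - 3 / 85 * e_T230 +
          3 / 170 * e_C11 - 3 / 85 * e_T311 - 3 / 85 * e_B12 - 3 / 170 * e_T231 - 6 / 85 * e_T313
          + 3 / 85 * e_B31 + 9 / 170 * e_C20 - 3 / 170 * e_B01 - 3 / 170 * e_T233 +
          9 / 170 * e_B23 - 3 / 340 * e_B11 + 3 / 85 * e_T332 - 21 / 170 * e_T121 +
          9 / 170 * e_B13 - 11 / 340 * e_T113
  have e_B21 : B 2 1 = 18 * B 2 0 - 2 * A 0 - C 1 2 := by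
    linear_combination (norm := (simp only [Fin.isValue, Fin.reduceAdd, Fin.reduceSub]; ring1))
      17 * h3 1 3 2 (by decide) + 34 * e6 + 17 * e_T122 - 17 * e_B02 + 17 * e_B22 - 17 * e_T321 -
          17 * e_T132 - 17 * e_T312 - 17 * e_C22 - 17 / 2 * e_C11 - 17 * e_T212 - 17 * e_B32 +
          17 * e_C33 - 17 * e_B12 - 17 * e_T211 + 17 * e_T231 - 51 * e_B31 - 51 * e_C30 +
          17 * e_C20 - 17 / 2 * e_T213 + 17 * e_B01 + 51 * e_T233 + 85 * e_B23 + 51 / 2 * e_B11 +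
          119 / 2 * e_T332 + 17 / 2 * e_T121 - 119 / 2 * e_B13 + 187 / 12 * e_T113 +
          935 / 3 * e_B10
  have e_C12 : C 1 2 = 275 / 7 * B 2 0 - T 3 2 3 - 37 / 7 * A 0 := by
    linear_combination (norm := (simp only [Fin.isValue, Fin.reduceAdd, Fin.reduceSub]; ring1))
      -d3 1 2 (by decide) + 2 * e8 - 2 * e_T122 + e_C13 + e_T123 + e_B02 + e_T132 + e_T312 - e_B33
          + 1 / 2 * e_C11 + e_T212 + e_B32 + e_B31 + 2 * e_C30 - 1 / 2 * e_T213 + e_B01 -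
          3 / 2 * e_B23 - 5 / 2 * e_T332 + 2 * e_T121 - 3 * e_B13 + 23 / 12 * e_T113 +
          190 / 3 * e_B10 + 167 / 68 * e_B21
  have e_T323 : T 3 2 3 = -8 / 7 * A 0 + 79 / 14 * B 2 0 := by
    linear_combination (norm := (simp only [Fin.isValue, Fin.reduceAdd, Fin.reduceSub]; ring1))
      5 / 12 * h3 1 1 2 (by decide) - 5 / 6 * e8 + 5 / 12 * e_T122 - 5 / 12 * e_C13 +
          5 / 6 * e_T102 - 5 / 12 * e_B22 - 5 / 6 * e_T120 + 5 / 12 * e_B33 - 5 / 6 * e_C22 -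
          5 / 12 * e_C10 - 5 / 12 * e_T212 - 5 / 12 * e_B32 - 5 / 6 * e_B12 - 5 / 6 * e_T313 -
          5 / 12 * e_B31 - 5 / 6 * e_C30 - 5 / 4 * e_B01 + 5 / 12 * e_T233 + 5 / 3 * e_B23 +
          5 / 24 * e_B11 + 5 / 12 * e_T332 + 5 / 12 * e_T121 - 5 / 4 * e_B13 + 5 / 9 * e_T113 +
          335 / 18 * e_B10 - 335 / 408 * e_B21 + 1 / 2 * e_C12
  have e_A0 : A 0 = 8 * B 2 0 := by
    linear_combination (norm := (simp only [Fin.isValue, Fin.reduceAdd, Fin.reduceSub]; ring1))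
      -7 / 10 * h3 2 1 1 (by decide) + 7 / 10 * e8 - 7 / 5 * e_T110 + 7 / 10 * e_C13 +
          7 / 5 * e_T132 + 7 / 10 * e_C11 + 7 / 10 * e_C10 + 7 / 10 * e_T211 - 7 / 10 * e_T231 +
          7 / 10 * e_B31 + 7 / 10 * e_C30 + 7 / 5 * e_C20 - 7 / 5 * e_T233 - 7 / 10 * e_B11 -
          7 / 10 * e_T332 - 21 / 10 * e_T121 + 7 / 2 * e_B13 - 7 / 6 * e_T113 - 91 / 3 * e_B10 +
          931 / 340 * e_B21 - 7 / 5 * e_C12 + 14 / 5 * e_T323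
  have e_B20 : B 2 0 = 0 := by
    linear_combination (norm := (simp only [Fin.isValue, Fin.reduceAdd, Fin.reduceSub]; ring1))
      -2 * d3 2 1 (by decide) - 4 * e3 - 2 * e1 + 2 * e_T321 + 2 * e_C22 - 2 * e_T212 - 2 * e_C33
          + 2 * e_B12 + 6 * e_T211 + 6 * e_B31 + 2 * e_C30 - 2 * e_C20 + 2 * e_T213 - 4 * e_T233 +
          2 * e_B23 + 4 * e_B11 + 18 * e_T121 - 6 * e_B13 - 7 / 2 * e_T113 - 272 * e_B10 +
          13 / 2 * e_B21 - 34 / 5 * e_C12 + 88 / 5 * e_T323 + 44 / 7 * e_A0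
  have z_B20 : B 2 0 = 0 := e_B20
  have z_A0 : A 0 = 0 := by simp [e_A0, z_B20]
  have z_T323 : T 3 2 3 = 0 := by simp [e_T323, z_A0, z_B20]
  have z_C12 : C 1 2 = 0 := by simp [e_C12, z_B20, z_T323, z_A0]
  have z_B21 : B 2 1 = 0 := by simp [e_B21, z_B20, z_A0, z_C12]
  have z_B10 : B 1 0 = 0 := by simp [e_B10, z_T323, z_B20, z_C12, z_A0, z_B21]
  have z_T113 : T 1 1 3 = 0 := by simp [e_T113, z_B20, z_B10, z_B21, z_A0, z_C12, z_T323]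
  have z_B13 : B 1 3 = 0 := by simp [e_B13, z_C12, z_B20, z_T323, z_A0, z_T113, z_B10, z_B21]
  have z_T121 : T 1 2 1 = 0 := by simp [e_T121, z_T323, z_B20, z_A0, z_B10, z_T113, z_B21, z_C12]
  have z_T332 : T 3 3 2 = 0 := by simp [e_T332, z_B10, z_B21, z_T113, z_B13, z_A0, z_B20, z_C12]
  have z_B11 : B 1 1 = 0 := by simp [e_B11, z_C12, z_T323, z_T121, z_B13, z_B21, z_B20, z_B10,
      z_A0]
  have z_B23 : B 2 3 = 0 := by simp [e_B23, z_T113, z_C12, z_A0, z_T121, z_T323, z_B20, z_B10,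
      z_B21]
  have z_T233 : T 2 3 3 = 0 := by simp [e_T233, z_A0, z_B13, z_C12, z_B23, z_B20, z_T113, z_B10,
      z_B11, z_T332]
  have z_B01 : B 0 1 = 0 := by simp [e_B01, z_B10, z_B20, z_A0, z_B11, z_B23, z_C12, z_B21, z_B13]
  have z_T213 : T 2 1 3 = 0 := by simp [e_T213, z_T233, z_T121, z_A0, z_B20, z_B23, z_B21, z_B01,
      z_C12, z_T113, z_T323, z_B13]
  have z_C20 : C 2 0 = 0 := by simp [e_C20, z_C12, z_B21, z_B10, z_B13, z_A0, z_B20, z_B23]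
  have z_C30 : C 3 0 = 0 := by simp [e_C30, z_B10, z_B13, z_B20, z_B11, z_C12, z_B23]
  have z_B31 : B 3 1 = 0 := by simp [e_B31, z_C12, z_B21, z_B11, z_B23, z_C30, z_B13, z_B20]
  have z_T313 : T 3 1 3 = 0 := by simp [e_T313, z_A0, z_C30, z_T332, z_B11, z_B10, z_C20, z_B20,
      z_B01, z_B23, z_T233, z_C12, z_T113]
  have z_T231 : T 2 3 1 = 0 := by simp [e_T231, z_T233, z_T332, z_B23, z_C20, z_B20, z_A0, z_B21,
      z_B10, z_B01, z_T113, z_B13]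
  have z_T211 : T 2 1 1 = 0 := by simp [e_T211, z_B21, z_T113, z_B10, z_B13, z_A0, z_T323, z_B11,
      z_B23]
  have z_B12 : B 1 2 = 0 := by simp [e_B12, z_C12, z_B10, z_B01, z_B13, z_C30]
  have z_C33 : C 3 3 = 0 := by simp [e_C33, z_B21, z_B10, z_B01, z_B13, z_B12, z_C30, z_B31, z_A0,
      z_B20]
  have z_B32 : B 3 2 = 0 := by simp [e_B32, z_B31, z_C30, z_B13, z_B11, z_B10, z_B23]
  have z_T130 : T 1 3 0 = 0 := by simp [e_T130, z_T113, z_B23, z_B13, z_B10, z_B01, z_B11, z_A0]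
  have z_T212 : T 2 1 2 = 0 := by simp [e_T212, z_B10, z_B23, z_T233, z_B01, z_T332, z_T323,
      z_B13]
  have z_T311 : T 3 1 1 = 0 := by simp [e_T311, z_B01, z_T121, z_T323, z_T130, z_A0, z_B32, z_B12,
      z_B11, z_B10, z_B23]
  have z_C10 : C 1 0 = 0 := by simp [e_C10, z_B11, z_B10, z_A0, z_B13, z_B23]
  have z_C11 : C 1 1 = 0 := by simp [e_C11, z_B13, z_B23, z_B20]
  have z_C22 : C 2 2 = 0 := by simp [e_C22, z_C20, z_B20, z_A0]
  have z_B33 : B 3 3 = 0 := by simp [e_B33, z_C33, z_C30, z_A0, z_B20]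
  have z_T312 : T 3 1 2 = 0 := by simp [e_T312, z_T233, z_T323, z_T332, z_B13, z_T213, z_B33,
      z_B20]
  have z_T120 : T 1 2 0 = 0 := by simp [e_T120, z_B10, z_C22, z_A0, z_C20, z_B23, z_B21, z_T332,
      z_B20, z_C33, z_B33, z_C30]
  have z_T132 : T 1 3 2 = 0 := by simp [e_T132, z_C12, z_B21, z_T113, z_C11, z_B20, z_B11]
  have z_T232 : T 2 3 2 = 0 := by simp [e_T232, z_T121, z_T211, z_C22, z_B31, z_T212]
  have z_C21 : C 2 1 = 0 := by simp [e_C21, z_B12, z_B23, z_B11, z_C30, z_B31]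
  have z_T210 : T 2 1 0 = 0 := by simp [e_T210, z_T130, z_C12, z_A0, z_B13, z_B31, z_B12, z_T121,
      z_T323]
  have z_T321 : T 3 2 1 = 0 := by simp [e_T321, z_T231, z_C33, z_B11, z_T211, z_T332]
  have z_B22 : B 2 2 = 0 := by simp [e_B22, z_C22, z_A0, z_C20, z_B20]
  have z_B02 : B 0 2 = 0 := by simp [e_B02, z_B20, z_B22, z_C33, z_B33, z_C30]
  have z_C32 : C 3 2 = 0 := by simp [e_C32, z_B13, z_A0, z_B32, z_B12]
  have z_T230 : T 2 3 0 = 0 := by simp [e_T230, z_T231, z_C20, z_T113, z_C11, z_T233]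
  have z_T123 : T 1 2 3 = 0 := by simp [e_T123, z_T213, z_C11, z_B33, z_T233]
  have z_T322 : T 3 2 2 = 0 := by simp [e_T322, z_T232, z_C21, z_B12, z_T332, z_T211]
  have z_T102 : T 1 0 2 = 0 := by simp [e_T102, z_T120, z_C12, z_B12, z_T121, z_T313, z_T323,
      z_C30]
  have z_T333 : T 3 3 3 = 0 := by simp [e_T333, z_T323, z_T233, z_C22, z_B13, z_T212, z_T232]
  have z_T131 : T 1 3 1 = 0 := by simp [e_T131, z_C10, z_T130, z_B13, z_B01]
  have z_C13 : C 1 3 = 0 := by simp [e_C13, z_C10, z_B10, z_B01]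
  have z_T331 : T 3 3 1 = 0 := by simp [e_T331, z_C30, z_B21, z_T313]
  have z_T133 : T 1 3 3 = 0 := by simp [e_T133, z_T313, z_C12, z_T323, z_T121, z_C30]
  have z_T122 : T 1 2 2 = 0 := by simp [e_T122, z_T212, z_B32, z_T233]
  have z_A1 : A 1 = 0 := by simp [e_A1, z_B10, z_B01, z_B13]
  have z_A2 : A 2 = 0 := by simp [e_A2, z_C33, z_B33, z_C30]
  have z_T330 : T 3 3 0 = 0 := by simp [e_T330, z_B33, z_T312, z_T332, z_B20]
  have z_T302 : T 3 0 2 = 0 := by simp [e_T302, z_C32, z_B32, z_T311, z_T323]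
  have z_T201 : T 2 0 1 = 0 := by simp [e_T201, z_T212, z_B01, z_T213]
  have z_T223 : T 2 2 3 = 0 := by simp [e_T223, z_T201, z_T210, z_C21, z_B21, z_T211]
  have z_T222 : T 2 2 2 = 0 := by simp [e_T222, z_T122, z_T212, z_B32, z_T322, z_T232, z_T223,
      z_C21, z_B12, z_C20, z_B02]
  have z_T303 : T 3 0 3 = 0 := by simp [e_T303, z_T330, z_C33, z_B20]
  have z_B03 : B 0 3 = 0 := by simp [e_B03, z_C30]
  have z_A3 : A 3 = 0 := by simp [e_A3, z_C30, z_B31]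
  have z_T110 : T 1 1 0 = 0 := by simp [e_T110, z_B11, z_T132, z_B20]
  have z_T203 : T 2 0 3 = 0 := by simp [e_T203, z_T230, z_B23, z_T233]
  have z_T310 : T 3 1 0 = 0 := by simp [e_T310, z_B31, z_C30, z_T313]
  have z_T101 : T 1 0 1 = 0 := by simp [e_T101, z_T110, z_C11, z_B20]
  have z_T103 : T 1 0 3 = 0 := by simp [e_T103, z_T130, z_C13, z_B13]
  have z_T202 : T 2 0 2 = 0 := by simp [e_T202, z_T222, z_C20, z_B02]
  have z_T301 : T 3 0 1 = 0 := by simp [e_T301, z_C30, z_T313]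
  have z_T200 : T 2 0 0 = 0 := by simp [e_T200, z_T202, z_C22, z_B22, z_A0]
  have z_B00 : B 0 0 = 0 := by simp [e_B00, z_A0]
  have z_T220 : T 2 2 0 = 0 := by simp [e_T220, z_T202, z_C22, z_B22]
  refine ⟨?_, ?_, ?_, ?_⟩
  · simp [Fin.forall_fin_succ, z_A3, z_A2, z_A1, z_A0]
  · simp [Fin.forall_fin_succ, z_B00, z_B03, z_B02, z_B22, z_B33, z_B32, z_B12, z_B31, z_B01,
      z_B23, z_B11, z_B13, z_B10, z_B21, z_B20, e9]
  · simp [Fin.forall_fin_succ, z_C13, z_C32, z_C21, z_C22, z_C11, z_C10, z_C33, z_C30, z_C20,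
      z_C12, e1, e5]
  · simp [Fin.forall_fin_succ, z_T220, z_T200, z_T301, z_T202, z_T103, z_T101, z_T310, z_T203,
      z_T110, z_T303, z_T222, z_T223, z_T201, z_T302, z_T330, z_T122, z_T133, z_T331, z_T131,
      z_T333, z_T102, z_T322, z_T123, z_T230, z_T321, z_T210, z_T232, z_T132, z_T120, z_T312,
      z_T311, z_T212, z_T130, z_T211, z_T231, z_T313, z_T213, z_T233, z_T332, z_T121, z_T113,
      z_T323, e2, e3, e4, e6, e7, e8]


/-! ### Values at powers of `i` -/

theorem I_pow_val_add (a b : Fin 4) :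
    Complex.I ^ (a + b : Fin 4).val = Complex.I ^ a.val * Complex.I ^ b.val := by
  rw [Fin.val_add, ← pow_add, ← Complex.I_pow_eq_pow_mod]

theorem I_pow_val_sub (a b : Fin 4) :
    Complex.I ^ (a - b : Fin 4).val = Complex.I ^ a.val / Complex.I ^ b.val := by
  rw [eq_div_iff (pow_ne_zero _ Complex.I_ne_zero), ← I_pow_val_add, sub_add_cancel]

theorem I_pow_val_ne_one {a : Fin 4} (ha : a ≠ 0) : Complex.I ^ a.val ≠ 1 := by
  fin_cases a
  · exact absurd rfl ha
  all_goals norm_num [Complex.ext_iff, Complex.I_pow_three]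

theorem exists_eq_I_pow_val {z : ℂ} (hz : z ^ 4 = 1) : ∃ a : Fin 4, z = Complex.I ^ a.val := by
  have h : (z - 1) * (z + 1) * ((z - Complex.I) * (z + Complex.I)) = 0 := by
    linear_combination hz - (z ^ 2 - 1) * Complex.I_sq
  rcases mul_eq_zero.1 h with h | h <;> rcases mul_eq_zero.1 h with h | h
  · exact ⟨0, by simpa using sub_eq_zero.1 h⟩
  · exact ⟨2, by simpa using eq_neg_of_add_eq_zero_left h⟩
  · exact ⟨1, by simpa using sub_eq_zero.1 h⟩
  · exact ⟨3, by simpa [Complex.I_pow_three] using eq_neg_of_add_eq_zero_left h⟩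

/-- The lists of exponents and roots of unity defining the elements of `MPVset 3 4`. -/
theorem exists_of_mem_MPVset {x : ℂ} (hx : x ∈ MPVset 3 4) :
    (∃ a : Fin 4, x = Li [(3, Complex.I ^ a.val)]) ∨
    (∃ a b : Fin 4, x = Li [(2, Complex.I ^ a.val), (1, Complex.I ^ b.val)]) ∨
    (∃ a b : Fin 4, a ≠ 0 ∧ x = Li [(1, Complex.I ^ a.val), (2, Complex.I ^ b.val)]) ∨
    ∃ a b c : Fin 4, a ≠ 0 ∧
      x = Li [(1, Complex.I ^ a.val), (1, Complex.I ^ b.val), (1, Complex.I ^ c.val)] := by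
  obtain ⟨l, hl, hw, hh, rfl⟩ := hx
  match l with
  | [] => simp at hw
  | [(s, z)] =>
    simp only [List.forall_mem_cons, List.map_cons, List.map_nil, List.sum_cons, List.sum_nil]
      at hl hw
    obtain ⟨a, rfl⟩ := exists_eq_I_pow_val hl.1.2
    obtain rfl : s = 3 := by omega
    exact .inl ⟨a, rfl⟩
  | [(s, z), (s', z')] =>
    simp only [List.forall_mem_cons, List.map_cons, List.map_nil, List.sum_cons, List.sum_nil]
      at hl hw
    obtain ⟨⟨hs, hz⟩, ⟨hs', hz'⟩, -⟩ := hl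
    obtain ⟨a, rfl⟩ := exists_eq_I_pow_val hz
    obtain ⟨b, rfl⟩ := exists_eq_I_pow_val hz'
    obtain ⟨rfl, rfl⟩ | ⟨rfl, rfl⟩ : s = 2 ∧ s' = 1 ∨ s = 1 ∧ s' = 2 := by omega
    · exact .inr (.inl ⟨a, b, rfl⟩)
    · exact .inr (.inr (.inl ⟨a, b, by rintro rfl; simp at hh, rfl⟩))
  | [(s, z), (s', z'), (s'', z'')] =>
    simp only [List.forall_mem_cons, List.map_cons, List.map_nil, List.sum_cons, List.sum_nil]
      at hl hw
    obtain ⟨⟨hs, hz⟩, ⟨hs', hz'⟩, ⟨hs'', hz''⟩, -⟩ := hl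
    obtain ⟨a, rfl⟩ := exists_eq_I_pow_val hz
    obtain ⟨b, rfl⟩ := exists_eq_I_pow_val hz'
    obtain ⟨c, rfl⟩ := exists_eq_I_pow_val hz''
    obtain ⟨rfl, rfl, rfl⟩ : s = 1 ∧ s' = 1 ∧ s'' = 1 := by omega
    exact .inr (.inr (.inr ⟨a, b, c, by rintro rfl; simp at hh, rfl⟩))
  | (s, z) :: (s', z') :: (s'', z'') :: (s''', z''') :: l =>
    simp only [List.forall_mem_cons, List.map_cons, List.sum_cons] at hl hw
    omega

theorem Li_one_I_add_Li_one_neg_I :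
    Li [(1, Complex.I ^ (1 : Fin 4).val)] + Li [(1, Complex.I ^ (3 : Fin 4).val)]
      = Li [(1, Complex.I ^ (2 : Fin 4).val)] := by
  have h := Li_one_add_Li_one_neg (z := Complex.I) (by simp) (by norm_num [Complex.I_sq])
  have h3 : Complex.I ^ (3 : Fin 4).val = -Complex.I := Complex.I_pow_three
  rw [h3]
  simpa using h

theorem map_eq_zero_of_mem_MPVset (φ : ℂ →ₗ[ℚ] ℚ)
    (e1 : φ (Li [(1, -1), (2, -Complex.I)]) = 0)
    (e2 : φ (Li [(1, Complex.I), (1, 1), (1, 1)]) = 0)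
    (e3 : φ (Li [(1, -1), (1, -1), (1, Complex.I)]) = 0)
    (e4 : φ (Li [(1, Complex.I), (1, Complex.I), (1, Complex.I)]) = 0)
    (e5 : φ (Li [(1, -Complex.I), (2, Complex.I)]) = 0)
    (e6 : φ (Li [(1, -Complex.I), (1, -1), (1, 1)]) = 0)
    (e7 : φ (Li [(1, -Complex.I), (1, 1), (1, 1)]) = 0)
    (e8 : φ (Li [(1, Complex.I), (1, Complex.I), (1, -1)]) = 0)
    (e9 : φ (Li [(2, -Complex.I), (1, 1)]) = 0) {x : ℂ} (hx : x ∈ MPVset 3 4) : φ x = 0 := by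
  obtain ⟨z, hz⟩ : ∃ z : Fin 4 → ℂ, ∀ a, Complex.I ^ a.val = z a := ⟨_, fun _ => rfl⟩
  have hn (a : Fin 4) : ‖z a‖ = 1 := by simp [← hz]
  have hne {a : Fin 4} (ha : a ≠ 0) : z a ≠ 1 := hz a ▸ I_pow_val_ne_one ha
  have hadd (a b : Fin 4) : z (a + b) = z a * z b := by simp only [← hz, I_pow_val_add]
  have hsub (a b : Fin 4) : z (a - b) = z a / z b := by simp only [← hz, I_pow_val_sub]
  have hdist : Li [(1, z 1)] + Li [(1, z 3)] = Li [(1, z 2)] := by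
    simpa only [hz] using Li_one_I_add_Li_one_neg_I
  have h0 : z 0 = 1 := (hz 0).symm.trans (pow_zero _)
  have h1 : z 1 = Complex.I := (hz 1).symm.trans (pow_one _)
  have h2 : z 2 = -1 := (hz 2).symm.trans Complex.I_sq
  have h3 : z 3 = -Complex.I := (hz 3).symm.trans Complex.I_pow_three
  obtain ⟨hA, hB, hC, hT⟩ := eq_zero_of_level_four_relations
    (A := fun a => φ (Li [(3, z a)]))
    (B := fun a b => φ (Li [(2, z a), (1, z b)]))
    (C := fun a b => φ (Li [(1, z a), (2, z b)]))
    (T := fun a b c => φ (Li [(1, z a), (1, z b), (1, z c)]))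
    (fun a b => by
      simp only [← map_add, hadd, hsub, Li_double_shuffle_two (hn a) (hn b)])
    (fun a b c hb => by
      simp only [← map_add, hadd, hsub, div_div,
        Li_double_shuffle_one_one (hn a) (hn b) (hn c) (hne hb)])
    (fun b => by
      have l (a : Fin 4) (ha : a ≠ 0) := Li_stuffle_two (hn a) (hn b) (hne ha)
      simp only [← map_add, hadd]
      rw [← l 1 (by decide), ← l 2 (by decide), ← l 3 (by decide), ← add_mul, hdist])
    (fun b c hb => by
      have l (a : Fin 4) (ha : a ≠ 0) := Li_stuffle_one_one (hn a) (hn b) (hn c) (hne ha) (hne hb)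
      simp only [← map_add, hadd]
      rw [← l 1 (by decide), ← l 2 (by decide), ← l 3 (by decide), ← add_mul, hdist])
    (by rw [h2, h3, e1]) (by rw [h1, h0, e2]) (by rw [h2, h1, e3]) (by rw [h1, e4])
    (by rw [h3, h1, e5]) (by rw [h3, h2, h0, e6]) (by rw [h3, h0, e7]) (by rw [h1, h2, e8])
    (by rw [h3, h0, e9])
  have hx := exists_of_mem_MPVset hx
  simp only [hz] at hx
  obtain ⟨a, rfl⟩ | ⟨a, b, rfl⟩ | ⟨a, b, ha, rfl⟩ | ⟨a, b, c, ha, rfl⟩ := hx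
  · exact hA a
  · exact hB a b
  · exact hC a b ha
  · exact hT a b c ha

theorem MPVset_subset_span {S : Set ℂ}
    (h1 : Li [(1, -1), (2, -Complex.I)] ∈ S)
    (h2 : Li [(1, Complex.I), (1, 1), (1, 1)] ∈ S)
    (h3 : Li [(1, -1), (1, -1), (1, Complex.I)] ∈ S)
    (h4 : Li [(1, Complex.I), (1, Complex.I), (1, Complex.I)] ∈ S)
    (h5 : Li [(1, -Complex.I), (2, Complex.I)] ∈ S)
    (h6 : Li [(1, -Complex.I), (1, -1), (1, 1)] ∈ S)
    (h7 : Li [(1, -Complex.I), (1, 1), (1, 1)] ∈ S)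
    (h8 : Li [(1, Complex.I), (1, Complex.I), (1, -1)] ∈ S)
    (h9 : Li [(2, -Complex.I), (1, 1)] ∈ S) :
    MPVset 3 4 ⊆ (Submodule.span ℚ S : Set ℂ) := by
  intro x hx
  by_contra h
  obtain ⟨φ, hφ, hle⟩ := Submodule.exists_le_ker_of_notMem h
  have hS : ∀ y ∈ S, φ y = 0 := fun y hy => hle (Submodule.subset_span hy)
  exact hφ (map_eq_zero_of_mem_MPVset φ (hS _ h1) (hS _ h2) (hS _ h3) (hS _ h4) (hS _ h5)
    (hS _ h6) (hS _ h7) (hS _ h8) (hS _ h9) hx)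

theorem rank_MPV_le {w N : ℕ} {S : Set ℂ} (h : MPVset w N ⊆ (Submodule.span ℚ S : Set ℂ)) :
    Module.rank ℚ ↥(MPV w N) ≤ Cardinal.mk S :=
  (Submodule.rank_mono (Submodule.span_le.2 h)).trans (rank_span_le S)

theorem mk_nine_le {α : Type*} (a b c d e f g h i : α) :
    Cardinal.mk ({a, b, c, d, e, f, g, h, i} : Set α) ≤ 9 := by
  classical
  have hs : ({a, b, c, d, e, f, g, h, i} : Set α)
      = (({a, b, c, d, e, f, g, h, i} : Finset α) : Set α) := by simp
  rw [hs]
  refine (Cardinal.mk_coe_finset (s := ({a, b, c, d, e, f, g, h, i} : Finset α))).trans_le ?_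
  have h0 := Finset.card_le_six (a := d) (b := e) (c := f) (d := g) (e := h) (f := i)
  exact_mod_cast (Finset.card_insert_le _ _).trans (Nat.add_le_add_right
    ((Finset.card_insert_le _ _).trans (Nat.add_le_add_right
      ((Finset.card_insert_le _ _).trans (Nat.add_le_add_right h0 1)) 1)) 1)

open Complex in
/-- every multiple polylogarithm value of weight 3 and level 4 is a
`ℚ`-linear combination of the nine values `Li_{1,2}(−1,−i)`, `Li_{1,1,1}(i,1,1)`,
`Li_{1,1,1}(−1,−1,i)`, `Li_{1,1,1}(i,i,i)`, `Li_{1,2}(−i,i)`, `Li_{1,1,1}(−i,−1,1)`,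
`Li_{1,1,1}(−i,1,1)`, `Li_{1,1,1}(i,i,−1)`, `Li_{2,1}(−i,1)`;
in particular `d(3,4) ≤ 9`. -/
theorem mpv_weight3_level4_span_nine :
    MPVset 3 4 ⊆
      (Submodule.span ℚ
        ({Li [(1, -1), (2, -I)],
          Li [(1, I), (1, 1), (1, 1)],
          Li [(1, -1), (1, -1), (1, I)],
          Li [(1, I), (1, I), (1, I)],
          Li [(1, -I), (2, I)],
          Li [(1, -I), (1, -1), (1, 1)],
          Li [(1, -I), (1, 1), (1, 1)],
          Li [(1, I), (1, I), (1, -1)],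
          Li [(2, -I), (1, 1)]} : Set ℂ) : Set ℂ)
    ∧ Module.rank ℚ ↥(MPV 3 4) ≤ 9 := by
  have h := MPVset_subset_span (S := {Li [(1, -1), (2, -I)],
    Li [(1, I), (1, 1), (1, 1)], Li [(1, -1), (1, -1), (1, I)], Li [(1, I), (1, I), (1, I)],
    Li [(1, -I), (2, I)], Li [(1, -I), (1, -1), (1, 1)], Li [(1, -I), (1, 1), (1, 1)],
    Li [(1, I), (1, I), (1, -1)], Li [(2, -I), (1, 1)]})
    (by simp) (by simp) (by simp) (by simp) (by simp) (by simp) (by simp) (by simp) (by simp)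
  exact ⟨h, (rank_MPV_le h).trans (mk_nine_le ..)⟩
end

section
/- Every multiple polylogarithm value of weight 3 and level 4 is a ℚ-linear combination of the following eight values: Li_{1,1,1}(i,1,1), Li_{1,1,1}(−1,−1,i), Li_{1,1,1}(i,i,i), Li_{1,2}(−i,i), Li_{1,1,1}(−i,−1,1), Li_{1,1,1}(−i,1,1), Li_{1,1,1}(i,i,−1), Li_{2,1}(−i,1). In particular d(3,4) ≤ 8. -/
open Filter Topology

/-- The vertices `0`, `∞` and the fourth roots of unity of the octahedron in the Riemann sphere.
The vertex `root k` stands for the pole at `I ^ (-k)`. -/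
inductive Vertex
  | zero
  | inf
  | root (k : Fin 4)

namespace Vertex

/-- The inverse of the affine coordinate of a nonzero vertex. -/
noncomputable def slope : Vertex → ℂ
  | zero => 0
  | inf => 0
  | root k => Complex.I ^ (k : ℕ)

/-- The density of the differential form `-d log (x - p)` attached to a vertex `p`; it vanishes
for `p = ∞`. -/
noncomputable def form : Vertex → ℝ → ℂ
  | zero, x => -1 / (x : ℂ)
  | a, x => a.slope / (1 - a.slope * x)

lemma slope_root_zero : (root 0).slope = 1 := by simp [slope]

lemma slope_root_one : (root 1).slope = Complex.I := by simp [slope]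

lemma slope_root_two : (root 2).slope = -1 := by simp [slope]

lemma slope_root_three : (root 3).slope = -Complex.I := by simp [slope]

lemma norm_slope_le (a : Vertex) : ‖a.slope‖ ≤ 1 := by
  cases a <;> simp [slope]

/-- Taylor coefficients at `0` of the iterated integral of the forms attached to a word, the first
letter being the outermost one. -/
noncomputable def coef : List Vertex → ℕ → ℂ
  | [], n => if n = 0 then 1 else 0
  | zero :: w, n => -(coef w n / n)
  | a :: w, n => (∑ k ∈ Finset.range n, a.slope ^ (n - k) * coef w k) / n

/-- The iterated integral from `0` to `x` of the forms attached to a word. -/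
noncomputable def iter (w : List Vertex) (x : ℝ) : ℂ := ∑' n, coef w n * (x : ℂ) ^ n

/-- The iterated integral from `0` to `1` of the forms attached to a word. -/
noncomputable def val (w : List Vertex) : ℂ :=
  limUnder atTop fun m => ∑ k ∈ Finset.range m, coef w k

lemma coef_cons {a : Vertex} (ha : a ≠ zero) (w : List Vertex) (n : ℕ) :
    coef (a :: w) n = (∑ k ∈ Finset.range n, a.slope ^ (n - k) * coef w k) / n := by
  cases a <;> simp_all [coef]

lemma form_of_ne_zero {a : Vertex} (ha : a ≠ zero) (x : ℝ) :
    form a x = a.slope / (1 - a.slope * x) := by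
  cases a <;> simp_all [form]

lemma sum_pow_sub_mul_succ (z : ℂ) (c : ℕ → ℂ) (n : ℕ) :
    ∑ k ∈ Finset.range (n + 1), z ^ (n + 1 - k) * c k
      = z * (∑ k ∈ Finset.range n, z ^ (n - k) * c k + c n) := by
  rw [Finset.sum_range_succ, mul_add, Finset.mul_sum]
  congr 1
  · refine Finset.sum_congr rfl fun k hk => ?_
    have := Finset.mem_range.1 hk
    rw [show n + 1 - k = (n - k) + 1 by omega]
    ring
  · simp

lemma coef_cons_zero (a : Vertex) (w : List Vertex) : coef (a :: w) 0 = 0 := by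
  cases a <;> simp [coef]

lemma coef_of_inf_mem {w : List Vertex} (hw : inf ∈ w) (n : ℕ) : coef w n = 0 := by
  induction w generalizing n with
  | nil => simp at hw
  | cons a w ih =>
    rcases List.mem_cons.1 hw with rfl | h
    · rw [coef_cons (by simp), Finset.sum_eq_zero, zero_div]
      intro k hk
      have : n - k ≠ 0 := by have := Finset.mem_range.1 hk; omega
      simp [slope, this]
    · cases a <;> simp [coef, ih h]

lemma norm_coef_cons_le {a : Vertex} (ha : a ≠ zero) (w : List Vertex) (n : ℕ) :
    ‖coef (a :: w) n‖ ≤ (∑ k ∈ Finset.range n, ‖coef w k‖) / n := by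
  rw [coef_cons ha, norm_div, Complex.norm_natCast]
  gcongr
  refine (norm_sum_le _ _).trans (Finset.sum_le_sum fun k _ => ?_)
  rw [norm_mul, norm_pow]
  exact mul_le_of_le_one_left (norm_nonneg _) (pow_le_one₀ (norm_nonneg _) (norm_slope_le a))

lemma sum_inv_sqrt_le (n : ℕ) : ∑ k ∈ Finset.range n, 1 / √(k : ℝ) ≤ 2 * √(n : ℝ) := by
  suffices ∑ k ∈ Finset.range (n + 1), 1 / √(k : ℝ) ≤ 2 * √(n : ℝ) by
    refine le_trans ?_ this
    rw [Finset.sum_range_succ]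
    exact le_add_of_nonneg_right (by positivity)
  induction n with
  | zero => simp
  | succ n ih =>
    rw [Finset.sum_range_succ]
    have h1 : 0 < √((n + 1 : ℕ) : ℝ) := by positivity
    have e0 : √(n : ℝ) ^ 2 = n := Real.sq_sqrt (by positivity)
    have e1 : √((n + 1 : ℕ) : ℝ) ^ 2 = n + 1 := by
      rw [Real.sq_sqrt (by positivity)]; push_cast; ring
    have h2 : 1 / √((n + 1 : ℕ) : ℝ) ≤ 2 * (√((n + 1 : ℕ) : ℝ) - √(n : ℝ)) := by
      rw [div_le_iff₀ h1]
      nlinarith [sq_nonneg (√((n + 1 : ℕ) : ℝ) - √(n : ℝ))]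
    linarith

/-- The coefficients of a word decay like an inverse square root. -/
lemma exists_coef_bound (w : List Vertex) :
    ∃ C : ℝ, 0 ≤ C ∧ (∀ n, ∑ k ∈ Finset.range n, ‖coef w k‖ ≤ C * √(n : ℝ)) ∧
      (w ≠ [] → ∀ n, ‖coef w n‖ ≤ C / √(n : ℝ)) := by
  induction w with
  | nil =>
    refine ⟨1, by norm_num, fun n => ?_, by simp⟩
    rcases Nat.eq_zero_or_pos n with rfl | hn
    · simp
    have : ∑ k ∈ Finset.range n, ‖coef [] k‖ = 1 := by
      rw [Finset.sum_eq_single 0] <;> simp_all [coef]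
    rw [this, one_mul, Real.one_le_sqrt]
    exact_mod_cast hn
  | cons a w ih =>
    obtain ⟨C, hC, hs, -⟩ := ih
    have key : ∀ n : ℕ, ‖coef (a :: w) n‖ ≤ (2 * C) / √(n : ℝ) := by
      intro n
      rcases Nat.eq_zero_or_pos n with rfl | hn
      · simp [coef_cons_zero]
      have hn' : (0 : ℝ) < n := by exact_mod_cast hn
      have h0 : 0 < √(n : ℝ) := by positivity
      have e0 : √(n : ℝ) * √(n : ℝ) = n := Real.mul_self_sqrt hn'.le
      have hle : ‖coef (a :: w) n‖ ≤ (∑ k ∈ Finset.range (n + 1), ‖coef w k‖) / n := by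
        by_cases ha : a = zero
        · subst ha
          rw [coef, norm_neg, norm_div, Complex.norm_natCast, Finset.sum_range_succ]
          gcongr
          exact le_add_of_nonneg_left (Finset.sum_nonneg fun _ _ => norm_nonneg _)
        · refine (norm_coef_cons_le ha w n).trans ?_
          rw [Finset.sum_range_succ]
          gcongr
          exact le_add_of_nonneg_right (norm_nonneg _)
      have h2 : √((n + 1 : ℕ) : ℝ) ≤ 2 * √(n : ℝ) := by
        rw [show (2 : ℝ) * √(n : ℝ) = √(4 * n) by
          rw [Real.sqrt_mul (by norm_num), show (4 : ℝ) = 2 ^ 2 by norm_num,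
            Real.sqrt_sq (by norm_num)]]
        apply Real.sqrt_le_sqrt
        have : (1 : ℝ) ≤ n := by exact_mod_cast hn
        push_cast; linarith
      refine hle.trans ?_
      rw [div_le_div_iff₀ hn' h0]
      calc (∑ k ∈ Finset.range (n + 1), ‖coef w k‖) * √(n : ℝ)
          ≤ (C * (2 * √(n : ℝ))) * √(n : ℝ) := by
            gcongr
            exact (hs _).trans (by gcongr)
        _ = 2 * C * (√(n : ℝ) * √(n : ℝ)) := by ring
        _ = 2 * C * n := by rw [e0]
    refine ⟨4 * C, by positivity, fun n => ?_, fun _ n => ?_⟩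
    · calc ∑ k ∈ Finset.range n, ‖coef (a :: w) k‖
          ≤ ∑ k ∈ Finset.range n, (2 * C) * (1 / √(k : ℝ)) :=
            Finset.sum_le_sum fun k _ => (key k).trans_eq (by ring)
        _ = 2 * C * ∑ k ∈ Finset.range n, 1 / √(k : ℝ) := by rw [Finset.mul_sum]
        _ ≤ 2 * C * (2 * √(n : ℝ)) := by gcongr; exact sum_inv_sqrt_le n
        _ = 4 * C * √(n : ℝ) := by ring
    · refine (key n).trans ?_
      gcongr
      norm_num

lemma exists_norm_coef_le (w : List Vertex) : ∃ C : ℝ, ∀ n, ‖coef w n‖ ≤ C := by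
  obtain ⟨C, hC, -, h⟩ := exists_coef_bound w
  rcases w.eq_nil_or_concat with rfl | hw
  · exact ⟨1, fun n => by by_cases h : n = 0 <;> simp [coef, h]⟩
  have hw' : w ≠ [] := by obtain ⟨_, _, rfl⟩ := hw; simp
  refine ⟨C, fun n => (h hw' n).trans ?_⟩
  rcases Nat.eq_zero_or_pos n with rfl | hn
  · simpa
  exact div_le_self hC (Real.one_le_sqrt.2 (by exact_mod_cast hn))

lemma tendsto_coef (w : List Vertex) : Tendsto (coef w) atTop (𝓝 0) := by
  obtain ⟨C, hC, -, h⟩ := exists_coef_bound w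
  by_cases hw : w = []
  · subst hw
    refine tendsto_const_nhds.congr' ?_
    filter_upwards [eventually_ne_atTop 0] with n hn
    simp [coef, hn]
  · refine squeeze_zero_norm (h hw) ?_
    exact (tendsto_const_nhds.div_atTop
      (Real.tendsto_sqrt_atTop.comp tendsto_natCast_atTop_atTop))

lemma summable_mul_pow_of_bound {c : ℕ → ℂ} {C : ℝ} (hc : ∀ n, ‖c n‖ ≤ C) {x : ℝ} (hx : |x| < 1) :
    Summable fun n => c n * (x : ℂ) ^ n := by
  refine Summable.of_norm_bounded (g := fun n => C * |x| ^ n)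
    ((summable_geometric_of_lt_one (abs_nonneg x) hx).mul_left C) fun n => ?_
  rw [norm_mul, norm_pow, Complex.norm_real, Real.norm_eq_abs]
  gcongr
  exact hc n

lemma norm_mul_mul_pow_le {c : ℕ → ℂ} {C : ℝ} (hc : ∀ n, ‖c n‖ ≤ C) {x r : ℝ} (hx : |x| ≤ r)
    (n : ℕ) : ‖c n * (n * (x : ℂ) ^ (n - 1))‖ ≤ C * (n * r ^ (n - 1)) := by
  rw [norm_mul, norm_mul, norm_pow, Complex.norm_natCast, Complex.norm_real, Real.norm_eq_abs]
  have hC : 0 ≤ C := (norm_nonneg _).trans (hc 0)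
  gcongr
  exact hc n

lemma summable_nat_mul_pow_pred {r : ℝ} (hr0 : 0 ≤ r) (hr : r < 1) :
    Summable fun n : ℕ => (n : ℝ) * r ^ (n - 1) := by
  rw [← summable_nat_add_iff 1]
  have h1 := summable_pow_mul_geometric_of_norm_lt_one (R := ℝ) 1
    (show ‖r‖ < 1 by rwa [Real.norm_of_nonneg hr0])
  refine (h1.add (summable_geometric_of_lt_one hr0 hr)).congr fun n => ?_
  rw [pow_one, Nat.add_sub_cancel, Nat.cast_add, Nat.cast_one]
  ring

lemma hasDerivAt_tsum_mul_pow {c : ℕ → ℂ} {C : ℝ} (hc : ∀ n, ‖c n‖ ≤ C) {x : ℝ} (hx : |x| < 1) :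
    HasDerivAt (fun y : ℝ => ∑' n, c n * (y : ℂ) ^ n)
      (∑' n, c n * (n * (x : ℂ) ^ (n - 1))) x := by
  obtain ⟨r, hxr, hr⟩ := exists_between hx
  have hr0 : 0 < r := (abs_nonneg x).trans_lt hxr
  refine hasDerivAt_tsum_of_isPreconnected (t := Set.Ioo (-r) r) (y₀ := 0)
    (g := fun n (y : ℝ) => c n * (y : ℂ) ^ n) (g' := fun n (y : ℝ) => c n * (n * (y : ℂ) ^ (n - 1)))
    ((summable_nat_mul_pow_pred hr0.le hr).mul_left C) isOpen_Ioo
    isPreconnected_Ioo (fun n y _ => ?_)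
    (fun n y hy => norm_mul_mul_pow_le hc (abs_lt.2 hy).le n) ⟨by linarith, hr0⟩
    (summable_mul_pow_of_bound hc (by simp)) (abs_lt.1 hxr)
  exact ((hasDerivAt_pow n (y : ℂ)).comp_ofReal).const_mul (c n)

/-- The differential equation satisfied by the iterated integrals. -/
lemma hasDerivAt_iter_cons (a : Vertex) {w : List Vertex} (h : a ≠ zero ∨ w ≠ []) {x : ℝ}
    (hx0 : 0 < x) (hx : x < 1) : HasDerivAt (iter (a :: w)) (form a x * iter w x) x := by
  have hx' : |x| < 1 := by rwa [abs_of_pos hx0]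
  have hxc : (x : ℂ) ≠ 0 := by exact_mod_cast hx0.ne'
  obtain ⟨C, hC⟩ := exists_norm_coef_le (a :: w)
  obtain ⟨C', hC'⟩ := exists_norm_coef_le w
  have hder := hasDerivAt_tsum_mul_pow hC hx'
  have hw := summable_mul_pow_of_bound hC' hx'
  suffices form a x * iter w x = ∑' n, coef (a :: w) n * (n * (x : ℂ) ^ (n - 1)) by
    rw [this]; exact hder
  by_cases ha : a = zero
  · subst ha
    have hne : w ≠ [] := by simpa using h
    rw [show form zero x = -1 / (x : ℂ) from rfl, iter, ← tsum_mul_left]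
    congr 1 with n
    rcases Nat.eq_zero_or_pos n with rfl | hn
    · obtain ⟨b, v, rfl⟩ := List.exists_cons_of_ne_nil hne
      simp [coef_cons_zero]
    · obtain ⟨m, rfl⟩ := Nat.exists_eq_succ_of_ne_zero hn.ne'
      have : ((m + 1 : ℕ) : ℂ) ≠ 0 := by exact_mod_cast m.succ_ne_zero
      simp only [coef, Nat.succ_eq_add_one, add_tsub_cancel_right]
      field_simp
      ring
  · set D : ℕ → ℂ := fun n => ∑ k ∈ Finset.range n, a.slope ^ (n - k) * coef w k with hD
    have hD0 : D 0 = 0 := by simp [hD]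
    have hDs : ∀ n, D (n + 1) = a.slope * (D n + coef w n) := sum_pow_sub_mul_succ _ _
    have hterm : ∀ n : ℕ, coef (a :: w) n * (n * (x : ℂ) ^ (n - 1)) = D n * (x : ℂ) ^ (n - 1) := by
      intro n
      rcases Nat.eq_zero_or_pos n with rfl | hn
      · simp [hD0]
      · have : (n : ℂ) ≠ 0 := by exact_mod_cast hn.ne'
        rw [coef_cons ha, ← mul_assoc, div_mul_cancel₀ _ this]
    have hsum : Summable fun n => D n * (x : ℂ) ^ (n - 1) := by
      refine Summable.of_norm_bounded
        ((summable_nat_mul_pow_pred (abs_nonneg x) hx').mul_left C) fun n => ?_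
      rw [← hterm]
      exact norm_mul_mul_pow_le hC le_rfl n
    have hshift : ∀ n, D n * (x : ℂ) ^ n = x * (D n * (x : ℂ) ^ (n - 1)) := by
      intro n
      rcases Nat.eq_zero_or_pos n with rfl | hn
      · simp [hD0]
      · obtain ⟨m, rfl⟩ := Nat.exists_eq_succ_of_ne_zero hn.ne'
        simp; ring
    have hode : ∑' n, D n * (x : ℂ) ^ (n - 1)
        = a.slope * (x * ∑' n, D n * (x : ℂ) ^ (n - 1) + iter w x) := by
      rw [← tsum_mul_left, iter, ← (hsum.mul_left (x : ℂ)).tsum_add hw, ← tsum_mul_left,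
        hsum.tsum_eq_zero_add]
      rw [hD0, zero_mul, zero_add]
      congr 1 with n
      rw [← hshift, Nat.add_sub_cancel, hDs]
      ring
    simp_rw [hterm]
    have hne : 1 - a.slope * (x : ℂ) ≠ 0 := by
      intro h0
      have h1 : ‖a.slope * (x : ℂ)‖ < 1 := by
        rw [norm_mul, Complex.norm_real, Real.norm_eq_abs]
        exact (mul_le_of_le_one_left (abs_nonneg _) (norm_slope_le a)).trans_lt hx'
      rw [← sub_eq_zero.1 h0, norm_one] at h1
      exact lt_irrefl _ h1
    rw [form_of_ne_zero ha, div_mul_eq_mul_div, div_eq_iff hne]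
    linear_combination -hode

/-- A word is admissible when its outermost letter is not the vertex `1`. -/
def NoPoleAtOne (w : List Vertex) : Prop := w.head? ≠ some (root 0)

lemma summable_div_sqrt (C : ℝ) : Summable fun n : ℕ => C / √(n : ℝ) / n := by
  have := (Real.summable_one_div_nat_rpow (p := 3 / 2)).2 (by norm_num)
  refine (this.mul_left C).congr fun n => ?_
  rcases Nat.eq_zero_or_pos n with rfl | hn
  · simp
  have hn' : (0 : ℝ) < n := by exact_mod_cast hn
  rw [show (3 / 2 : ℝ) = 1 / 2 + 1 by norm_num, Real.rpow_add_one hn'.ne', Real.sqrt_eq_rpow]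
  field_simp

lemma tendsto_partialSum_of_root {a : Vertex} (ha : a ≠ zero) (h1 : a.slope ≠ 1)
    (w : List Vertex) :
    ∃ v, Tendsto (fun m => ∑ k ∈ Finset.range m, coef (a :: w) k) atTop (𝓝 v) := by
  obtain ⟨C, hC, hs, -⟩ := exists_coef_bound w
  obtain ⟨C', hC', -, hc⟩ := exists_coef_bound (a :: w)
  have hsub : (1 - a.slope) ≠ 0 := sub_ne_zero.2 h1.symm
  set d : ℕ → ℂ := fun n => ∑ k ∈ Finset.range n, a.slope ^ (n - k) * coef w k with hd
  have hd0 : d 0 = 0 := by simp [hd]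
  have hds : ∀ n, d (n + 1) = a.slope * (d n + coef w n) := sum_pow_sub_mul_succ _ _
  have hdn : ∀ n : ℕ, ‖d n‖ ≤ C * √(n : ℝ) := by
    intro n
    refine (norm_sum_le _ _).trans ((Finset.sum_le_sum fun k _ => ?_).trans (hs n))
    rw [norm_mul, norm_pow]
    exact mul_le_of_le_one_left (norm_nonneg _) (pow_le_one₀ (norm_nonneg _) (norm_slope_le a))
  set E : ℕ → ℂ := fun m => ∑ n ∈ Finset.range m, d n with hE
  have hEeq : ∀ m, (1 - a.slope) * E m = a.slope * ∑ k ∈ Finset.range m, coef w k - d m := by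
    intro m
    induction m with
    | zero => simp [hE, hd0]
    | succ m ih =>
      simp only [hE, Finset.sum_range_succ] at ih ⊢
      rw [hds]
      linear_combination ih
  have hEn : ∀ m : ℕ, ‖E m‖ ≤ 2 * C / ‖1 - a.slope‖ * √(m : ℝ) := by
    intro m
    rw [div_mul_eq_mul_div, le_div_iff₀ (norm_pos_iff.2 hsub), mul_comm ‖E m‖, ← norm_mul, hEeq]
    refine (norm_sub_le _ _).trans ?_
    have h2 : ‖a.slope * ∑ k ∈ Finset.range m, coef w k‖ ≤ C * √(m : ℝ) := by
      rw [norm_mul]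
      exact (mul_le_of_le_one_left (norm_nonneg _) (norm_slope_le a)).trans
        ((norm_sum_le _ _).trans (hs m))
    linarith [hdn m]
  set B := 2 * C / ‖1 - a.slope‖ with hB
  have hB0 : 0 ≤ B := by positivity
  have hparts : ∀ m : ℕ, ∑ k ∈ Finset.range (m + 1), coef (a :: w) k
      = E (m + 1) / ((m + 1 : ℕ) : ℂ)
        + ∑ k ∈ Finset.range (m + 1), E (k + 1) / (k * ((k + 1 : ℕ) : ℂ)) := by
    intro m
    induction m with
    | zero => simp [hE, hd0, coef_cons_zero]
    | succ m ih =>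
      rw [Finset.sum_range_succ, ih, Finset.sum_range_succ _ (m + 1), coef_cons ha]
      have e : E (m + 1 + 1) = E (m + 1) + d (m + 1) := Finset.sum_range_succ _ _
      have h3 : ((m : ℂ) + 1) ≠ 0 := by exact_mod_cast m.succ_ne_zero
      have h4 : ((m : ℂ) + 1 + 1) ≠ 0 := by exact_mod_cast (m + 1).succ_ne_zero
      rw [e]
      change _ + d (m + 1) / _ = _
      push_cast
      field_simp
      ring
  have hdiv : ∀ m : ℕ, ‖E (m + 1) / ((m + 1 : ℕ) : ℂ)‖ ≤ B / √((m + 1 : ℕ) : ℝ) := by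
    intro m
    have h0 : (0 : ℝ) < √((m + 1 : ℕ) : ℝ) := by positivity
    have e0 := Real.mul_self_sqrt (Nat.cast_nonneg (α := ℝ) (m + 1))
    rw [norm_div, Complex.norm_natCast, div_le_div_iff₀ (by positivity) h0]
    calc ‖E (m + 1)‖ * √((m + 1 : ℕ) : ℝ) ≤ B * √((m + 1 : ℕ) : ℝ) * √((m + 1 : ℕ) : ℝ) := by
          gcongr; exact hEn _
      _ = B * ((m + 1 : ℕ) : ℝ) := by rw [mul_assoc, e0]
  have hlim : Tendsto (fun m : ℕ => E (m + 1) / ((m + 1 : ℕ) : ℂ)) atTop (𝓝 0) := by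
    refine squeeze_zero_norm hdiv ?_
    exact (tendsto_const_nhds.div_atTop (Real.tendsto_sqrt_atTop.comp
      (tendsto_natCast_atTop_atTop.comp (tendsto_add_atTop_nat 1))))
  have hsum : Summable fun k : ℕ => E (k + 1) / (k * ((k + 1 : ℕ) : ℂ)) := by
    refine Summable.of_norm_bounded (summable_div_sqrt B) fun k => ?_
    rcases Nat.eq_zero_or_pos k with rfl | hk
    · simp
    rw [mul_comm, ← div_div, norm_div, Complex.norm_natCast]
    gcongr
    refine (hdiv k).trans ?_
    gcongr
    exact Nat.le_succ k
  refine ⟨_, (tendsto_add_atTop_iff_nat 1).1 <| Tendsto.congr (fun m => (hparts m).symm)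
    (hlim.add ((tendsto_add_atTop_iff_nat 1).2 hsum.hasSum.tendsto_sum_nat))⟩

lemma tendsto_partialSum {w : List Vertex} (hw : NoPoleAtOne w) :
    Tendsto (fun m => ∑ k ∈ Finset.range m, coef w k) atTop (𝓝 (val w)) := by
  refine tendsto_nhds_limUnder ?_
  rcases w with - | ⟨a, w⟩
  · refine ⟨1, tendsto_const_nhds.congr' ?_⟩
    filter_upwards [eventually_ge_atTop 1] with n hn
    rw [Finset.sum_eq_single 0] <;> simp_all [coef]
    omega
  rcases a with - | - | k
  · by_cases hne : w = []
    · subst hne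
      refine ⟨0, tendsto_const_nhds.congr fun m => ?_⟩
      rw [Finset.sum_eq_zero]
      intro n _
      by_cases h : n = 0 <;> simp [coef, h]
    obtain ⟨C, hC, -, hc⟩ := exists_coef_bound w
    have hsum : Summable (coef (zero :: w)) := by
      refine Summable.of_norm_bounded (summable_div_sqrt C) fun n => ?_
      rw [coef, norm_neg, norm_div, Complex.norm_natCast]
      gcongr
      exact hc hne n
    exact ⟨_, hsum.hasSum.tendsto_sum_nat⟩
  · exact tendsto_partialSum_of_root (by simp) (by simp [slope]) w
  · refine tendsto_partialSum_of_root (by simp) ?_ w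
    have hk : k ≠ 0 := by rintro rfl; exact hw rfl
    fin_cases k
    · exact absurd rfl hk
    · simp [slope, Complex.ext_iff]
    · simp [slope, Complex.ext_iff]
      norm_num
    · simp [slope, Complex.ext_iff, pow_succ]

/-- Abel's limit theorem for iterated integrals. -/
lemma tendsto_iter_one {w : List Vertex} (hw : NoPoleAtOne w) :
    Tendsto (iter w) (𝓝[<] 1) (𝓝 (val w)) :=
  (tendsto_map'_iff.1 (Complex.tendsto_tsum_powerSeries_nhdsWithin_lt (tendsto_partialSum hw)))

lemma iter_zero (w : List Vertex) : iter w 0 = coef w 0 := by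
  rw [iter, tsum_eq_single 0]
  · simp
  · intro n hn
    simp [hn]

lemma differentiableAt_iter (w : List Vertex) {x : ℝ} (hx : |x| < 1) :
    DifferentiableAt ℝ (iter w) x := by
  obtain ⟨C, hC⟩ := exists_norm_coef_le w
  exact (hasDerivAt_tsum_mul_pow hC hx).differentiableAt

lemma tendsto_iter_zero {w : List Vertex} (hw : w ≠ []) :
    Tendsto (iter w) (𝓝 0) (𝓝 0) := by
  have h := (differentiableAt_iter w (x := 0) (by simp)).continuousAt.tendsto
  obtain ⟨a, v, rfl⟩ := List.exists_cons_of_ne_nil hw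
  rwa [iter_zero, coef_cons_zero] at h

/-- Near `1` the iterated integrals grow more slowly than `1 / (1 - x)`. -/
lemma tendsto_one_sub_mul_iter (w : List Vertex) :
    Tendsto (fun x : ℝ => ((1 - x : ℝ) : ℂ) * iter w x) (𝓝[<] 1) (𝓝 0) := by
  set c : ℕ → ℂ := fun n => coef w n - (if n = 0 then 0 else coef w (n - 1)) with hc
  have hpart : ∀ m, ∑ k ∈ Finset.range (m + 1), c k = coef w m := by
    intro m
    induction m with
    | zero => simp [hc]
    | succ m ih => rw [Finset.sum_range_succ, ih]; simp [hc]
  have ht : Tendsto (fun m => ∑ k ∈ Finset.range m, c k) atTop (𝓝 0) := by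
    rw [← tendsto_add_atTop_iff_nat 1]
    exact (tendsto_coef w).congr fun m => (hpart m).symm
  have := tendsto_map'_iff.1 (Complex.tendsto_tsum_powerSeries_nhdsWithin_lt ht)
  refine this.congr' ?_
  filter_upwards [Ioo_mem_nhdsLT (zero_lt_one' ℝ)] with x hx
  have hx' : |x| < 1 := by rw [abs_of_pos hx.1]; exact hx.2
  obtain ⟨C, hC⟩ := exists_norm_coef_le w
  have hs := summable_mul_pow_of_bound hC hx'
  have hs' : Summable fun n => (if n = 0 then 0 else coef w (n - 1)) * (x : ℂ) ^ n := by
    rw [← summable_nat_add_iff 1]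
    refine (hs.mul_left (x : ℂ)).congr fun n => ?_
    simp
    ring
  have e : ∑' n, (if n = 0 then 0 else coef w (n - 1)) * (x : ℂ) ^ n = x * iter w x := by
    rw [hs'.tsum_eq_zero_add, iter, ← tsum_mul_left]
    simp only [if_true, zero_mul, zero_add]
    congr 1 with n
    simp
    ring
  simp only [Function.comp, hc, sub_mul]
  rw [hs.tsum_sub hs', e, iter]
  push_cast
  ring

lemma eq_limit_of_hasDerivAt_zero {f : ℝ → ℂ} {A : ℂ}
    (hf : ∀ x, 0 < x → x < 1 → HasDerivAt f 0 x) (hA : Tendsto f (𝓝[>] 0) (𝓝 A)) {x : ℝ}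
    (hx0 : 0 < x) (hx : x < 1) : f x = A := by
  refine tendsto_nhds_unique (tendsto_const_nhds.congr' ?_) hA
  filter_upwards [Ioo_mem_nhdsGT (zero_lt_one' ℝ)] with y hy
  exact (isOpen_Ioo (a := (0 : ℝ)) (b := 1)).is_const_of_deriv_eq_zero isPreconnected_Ioo
    (fun y hy => (hf y hy.1 hy.2).differentiableAt.differentiableWithinAt)
    (fun y hy => (hf y hy.1 hy.2).deriv) ⟨hx0, hx⟩ hy

/-- A function on `(0, 1)` with vanishing derivative has the same limits at both ends. -/
lemma eq_of_tendsto_of_hasDerivAt_zero {f : ℝ → ℂ} {A B : ℂ}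
    (hf : ∀ x, 0 < x → x < 1 → HasDerivAt f 0 x)
    (hA : Tendsto f (𝓝[>] 0) (𝓝 A)) (hB : Tendsto f (𝓝[<] 1) (𝓝 B)) : A = B := by
  refine tendsto_nhds_unique (tendsto_const_nhds.congr' ?_) hB
  filter_upwards [Ioo_mem_nhdsLT (zero_lt_one' ℝ)] with x hx
  exact (eq_limit_of_hasDerivAt_zero hf hA hx.1 hx.2).symm

lemma iter_nil (x : ℝ) : iter [] x = 1 := by
  rw [iter, tsum_eq_single 0]
  · simp [coef]
  · intro n hn
    simp [coef, hn]

lemma hasDerivAt_iter_singleton {a : Vertex} (ha : a ≠ zero) {x : ℝ} (hx0 : 0 < x) (hx : x < 1) :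
    HasDerivAt (iter [a]) (form a x) x := by
  simpa [iter_nil] using hasDerivAt_iter_cons a (w := []) (Or.inl ha) hx0 hx

lemma iter_mul_iter_singleton {a b : Vertex} (ha : a ≠ zero) (hb : b ≠ zero) {x : ℝ}
    (hx0 : 0 < x) (hx : x < 1) : iter [a] x * iter [b] x = iter [a, b] x + iter [b, a] x := by
  have z : ∀ {w : List Vertex}, w ≠ [] → Tendsto (iter w) (𝓝[>] 0) (𝓝 0) := fun h =>
    (tendsto_iter_zero h).mono_left nhdsWithin_le_nhds
  refine sub_eq_zero.1 (eq_limit_of_hasDerivAt_zero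
    (f := fun x => iter [a] x * iter [b] x - (iter [a, b] x + iter [b, a] x))
    (fun x hx0 hx => ?_) ?_ hx0 hx)
  · have dd := ((hasDerivAt_iter_singleton ha hx0 hx).mul
      (hasDerivAt_iter_singleton hb hx0 hx)).sub
      ((hasDerivAt_iter_cons a (w := [b]) (by simp) hx0 hx).add
      (hasDerivAt_iter_cons b (w := [a]) (by simp) hx0 hx))
    refine dd.congr_deriv ?_
    ring
  · simpa using ((z (w := [a]) (by simp)).mul (z (w := [b]) (by simp))).sub
      ((z (w := [a, b]) (by simp)).add (z (w := [b, a]) (by simp)))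

/-- The shuffle product of words of lengths one and two. -/
lemma val_mul_val_shuffle {a b c : Vertex} (ha : a ≠ zero) (ha' : a ≠ root 0) (hb : b ≠ root 0)
    (hc : c ≠ zero) :
    val [a] * val [b, c] = val [a, b, c] + val [b, a, c] + val [b, c, a] := by
  have ta := tendsto_iter_one (w := [a]) (by simpa [NoPoleAtOne])
  have tbc := tendsto_iter_one (w := [b, c]) (by simpa [NoPoleAtOne])
  have tabc := tendsto_iter_one (w := [a, b, c]) (by simpa [NoPoleAtOne])
  have tbac := tendsto_iter_one (w := [b, a, c]) (by simpa [NoPoleAtOne])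
  have tbca := tendsto_iter_one (w := [b, c, a]) (by simpa [NoPoleAtOne])
  have z : ∀ {w : List Vertex}, w ≠ [] → Tendsto (iter w) (𝓝[>] 0) (𝓝 0) := fun h =>
    (tendsto_iter_zero h).mono_left nhdsWithin_le_nhds
  refine sub_eq_zero.1 (eq_of_tendsto_of_hasDerivAt_zero
    (f := fun x => iter [a] x * iter [b, c] x - (iter [a, b, c] x + iter [b, a, c] x
      + iter [b, c, a] x)) (fun x hx0 hx => ?_) (A := 0) ?_
    ((ta.mul tbc).sub ((tabc.add tbac).add tbca))).symm
  · have dd := ((hasDerivAt_iter_singleton ha hx0 hx).mul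
      (hasDerivAt_iter_cons b (w := [c]) (by simp) hx0 hx)).sub
      (((hasDerivAt_iter_cons a (w := [b, c]) (by simp) hx0 hx).add
      (hasDerivAt_iter_cons b (w := [a, c]) (by simp) hx0 hx)).add
      (hasDerivAt_iter_cons b (w := [c, a]) (by simp) hx0 hx))
    refine dd.congr_deriv ?_
    linear_combination form b x * iter_mul_iter_singleton ha hc hx0 hx
  · simpa using ((z (w := [a]) (by simp)).mul (z (w := [b, c]) (by simp))).sub
      (((z (w := [a, b, c]) (by simp)).add (z (w := [b, a, c]) (by simp))).add
        (z (w := [b, c, a]) (by simp)))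

/-- The action on vertices of the involution `x ↦ (1 - x) / (1 + x)`. -/
def refl : Vertex → Vertex
  | zero => root 0
  | inf => root 2
  | root 0 => zero
  | root 1 => root 3
  | root 2 => inf
  | root 3 => root 1

/-- The involution `x ↦ (1 - x) / (1 + x)` exchanging `0` and `1`. -/
noncomputable def swap (x : ℝ) : ℝ := (1 - x) / (1 + x)

lemma swap_pos {x : ℝ} (hx0 : 0 < x) (hx : x < 1) : 0 < swap x :=
  div_pos (by linarith) (by linarith)

lemma swap_lt_one {x : ℝ} (hx0 : 0 < x) : swap x < 1 := by
  rw [swap, div_lt_one (by linarith)]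
  linarith

lemma swap_swap {x : ℝ} (hx0 : 0 < x) : swap (swap x) = x := by
  have h : 1 + x ≠ 0 := by positivity
  have h' : 1 + (1 - x) / (1 + x) ≠ 0 := by
    rw [show 1 + (1 - x) / (1 + x) = 2 / (1 + x) by field_simp; ring]
    positivity
  rw [swap, swap, div_eq_iff h']
  field_simp
  ring

lemma hasDerivAt_swap {x : ℝ} (hx0 : 0 < x) : HasDerivAt swap (-2 / (1 + x) ^ 2) x := by
  have h : 1 + x ≠ 0 := by positivity
  refine (((hasDerivAt_id x).const_sub 1).div ((hasDerivAt_id x).const_add 1) h).congr_deriv ?_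
  simp only [id]
  ring

lemma continuousAt_swap {x : ℝ} (hx : 1 + x ≠ 0) : ContinuousAt swap x :=
  (continuousAt_const.sub continuousAt_id).div (continuousAt_const.add continuousAt_id) hx

lemma tendsto_swap_zero : Tendsto swap (𝓝[>] 0) (𝓝[<] 1) := by
  refine tendsto_nhdsWithin_iff.2 ⟨?_, ?_⟩
  · have := (continuousAt_swap (x := 0) (by norm_num)).tendsto
    rw [show swap 0 = 1 by simp [swap]] at this
    exact this.mono_left nhdsWithin_le_nhds
  · filter_upwards [self_mem_nhdsWithin] with x hx using swap_lt_one hx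

lemma tendsto_swap_one : Tendsto swap (𝓝[<] 1) (𝓝 0) := by
  have := (continuousAt_swap (x := 1) (by norm_num)).tendsto
  rw [show swap 1 = 0 by simp [swap]] at this
  exact this.mono_left nhdsWithin_le_nhds

/-- The forms are permuted by the involution, up to the form at the image of infinity. -/
lemma form_refl (a : Vertex) {x : ℝ} (hx0 : 0 < x) (hx : x < 1) :
    (form (refl a) (swap x) - form (root 2) (swap x)) * ((-2 / (1 + x) ^ 2 : ℝ) : ℂ)
      = form a x := by
  have hx1 : (x : ℂ) ≠ 0 := by exact_mod_cast hx0.ne'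
  have hx2 : 1 + (x : ℂ) ≠ 0 := by exact_mod_cast (by positivity : 1 + x ≠ 0)
  have hx3 : 1 - (x : ℂ) ≠ 0 := by exact_mod_cast (sub_pos.2 hx).ne'
  have hi : 1 + Complex.I * x ≠ 0 := fun h => by simpa using congrArg Complex.re h
  have hi' : 1 - Complex.I * x ≠ 0 := fun h => by simpa using congrArg Complex.re h
  have hj : 1 - Complex.I ≠ 0 := fun h => by simpa using congrArg Complex.re h
  have hj' : 1 + Complex.I ≠ 0 := fun h => by simpa using congrArg Complex.re h
  have hsw : ((swap x : ℝ) : ℂ) = (1 - x) / (1 + x) := by simp [swap]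
  have h2 : form (root 2) (swap x) = -(1 + x) / 2 := by
    have : (1 : ℂ) - -1 * ((1 - x) / (1 + x)) = 2 / (1 + x) := by field_simp; ring
    rw [form_of_ne_zero (by simp), hsw, slope_root_two, this]
    field_simp
  have hc : ((-2 / (1 + x) ^ 2 : ℝ) : ℂ) = -2 / (1 + (x : ℂ)) ^ 2 := by push_cast; rfl
  have hII := Complex.I_sq
  rcases a with - | - | k
  · have : (1 : ℂ) - 1 * ((1 - x) / (1 + x)) = 2 * x / (1 + x) := by field_simp; ring
    rw [h2, hc, refl, form_of_ne_zero (by simp), hsw, slope_root_zero, this, form]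
    field_simp
    ring
  · simp [refl, form, slope]
  · fin_cases k
    · change (form zero _ - _) * _ = form (root 0) x
      rw [h2, hc, form_of_ne_zero (a := root 0) (by simp), slope_root_zero, form, hsw, one_mul]
      field_simp
      ring
    · change (form (root 3) _ - _) * _ = form (root 1) x
      have : 1 - -Complex.I * ((1 - x) / (1 + x))
          = (1 + Complex.I) * (1 - Complex.I * x) / (1 + x) := by
        field_simp
        linear_combination x * hII
      rw [h2, hc, form_of_ne_zero (by simp), form_of_ne_zero (by simp), slope_root_one,
        slope_root_three, hsw, this]
      field_simp
      linear_combination -hII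
    · change (form inf _ - _) * _ = form (root 2) x
      rw [h2, hc, form_of_ne_zero (by simp), form_of_ne_zero (by simp), slope_root_two, slope,
        neg_one_mul, sub_neg_eq_add]
      field_simp
      ring
    · change (form (root 1) _ - _) * _ = form (root 3) x
      have : 1 - Complex.I * ((1 - x) / (1 + x))
          = (1 - Complex.I) * (1 + Complex.I * x) / (1 + x) := by
        field_simp
        linear_combination x * hII
      rw [h2, hc, form_of_ne_zero (by simp), form_of_ne_zero (by simp), slope_root_one,
        slope_root_three, hsw, this, neg_mul, sub_neg_eq_add]
      field_simp
      linear_combination -hII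

/-- The linear extension of `g` evaluated on the word obtained from `w` by replacing every form
by its image under the involution. -/
def pull (g : List Vertex → ℂ) : List Vertex → ℂ
  | [] => g []
  | a :: w => pull (fun v => g (refl a :: v)) w - pull (fun v => g (root 2 :: v)) w

lemma pull_mul (k : ℂ) (g : List Vertex → ℂ) (w : List Vertex) :
    pull (fun v => k * g v) w = k * pull g w := by
  induction w generalizing g with
  | nil => rfl
  | cons a w ih => simp only [pull]; rw [ih, ih, mul_sub]

lemma hasDerivAt_pull {g : List Vertex → ℝ → ℂ} {g' : List Vertex → ℂ} {x : ℝ} (w : List Vertex)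
    (h : ∀ v, v.length = w.length → HasDerivAt (g v) (g' v) x) :
    HasDerivAt (fun y => pull (fun v => g v y) w) (pull g' w) x := by
  induction w generalizing g g' with
  | nil => exact h [] rfl
  | cons a w ih =>
    exact (ih fun v hv => h (refl a :: v) (by simp [hv])).sub
      (ih fun v hv => h (root 2 :: v) (by simp [hv]))

lemma tendsto_pull {g : List Vertex → ℝ → ℂ} {g' : List Vertex → ℂ} {l : Filter ℝ}
    (w : List Vertex) (h : ∀ v, v.length = w.length → Tendsto (g v) l (𝓝 (g' v))) :
    Tendsto (fun y => pull (fun v => g v y) w) l (𝓝 (pull g' w)) := by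
  induction w generalizing g g' with
  | nil => exact h [] rfl
  | cons a w ih =>
    exact (ih fun v hv => h (refl a :: v) (by simp [hv])).sub
      (ih fun v hv => h (root 2 :: v) (by simp [hv]))

lemma pull_zero (w : List Vertex) : pull (fun _ => 0) w = 0 := by
  simpa using pull_mul 0 (fun _ => 0) w

/-- The iterated integral from `x` to `1` of a reversed word, up to sign. -/
noncomputable def coiter (w : List Vertex) (x : ℝ) : ℂ := pull (fun v => iter v (swap x)) w

lemma hasDerivAt_coiter_cons (a : Vertex) {w : List Vertex} (h : a ≠ root 0 ∨ w ≠ []) {x : ℝ}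
    (hx0 : 0 < x) (hx : x < 1) : HasDerivAt (coiter (a :: w)) (form a x * coiter w x) x := by
  have hs : ∀ b v, (b ≠ zero ∨ v ≠ []) → HasDerivAt (fun y => iter (b :: v) (swap y))
      (form b (swap x) * ((-2 / (1 + x) ^ 2 : ℝ) : ℂ) * iter v (swap x)) x := by
    intro b v hb
    refine ((hasDerivAt_iter_cons b hb (swap_pos hx0 hx) (swap_lt_one hx0)).scomp x
      (hasDerivAt_swap hx0)).congr_deriv ?_
    rw [Complex.real_smul]
    ring
  have hne : ∀ v : List Vertex, v.length = w.length → w ≠ [] → v ≠ [] := by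
    rintro v hv hw rfl
    exact hw (List.length_eq_zero_iff.1 hv.symm)
  have ha : a ≠ root 0 → refl a ≠ zero := by
    rcases a with - | - | k
    · simp [refl]
    · simp [refl]
    · fin_cases k <;> simp [refl]
  refine ((hasDerivAt_pull w fun v hv => hs (refl a) v (h.imp ha (hne v hv))).sub
    (hasDerivAt_pull w fun v _ => hs (root 2) v (Or.inl (by simp)))).congr_deriv ?_
  rw [pull_mul, pull_mul, ← form_refl a hx0 hx, coiter]
  ring

lemma tendsto_iter_mul_iter_swap_one (u : List Vertex) {v : List Vertex} (hv : v ≠ []) :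
    Tendsto (fun x => iter u x * iter v (swap x)) (𝓝[<] 1) (𝓝 0) := by
  have hO : iter v =O[𝓝 0] fun y : ℝ => y := by
    have := (differentiableAt_iter v (x := 0) (by simp)).isBigO_sub
    obtain ⟨a, w, rfl⟩ := List.exists_cons_of_ne_nil hv
    simpa [iter_zero, coef_cons_zero] using this
  have hO' := (Asymptotics.isBigO_refl (iter u) (𝓝[<] 1)).mul
    ((hO.comp_tendsto tendsto_swap_one).trans (k := fun x => ((swap x : ℝ) : ℂ))
      (Asymptotics.IsBigO.of_bound 1 (Eventually.of_forall fun x => by simp)))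
  refine hO'.trans_tendsto ?_
  have h := (tendsto_one_sub_mul_iter u).mul
    (((Complex.continuous_ofReal.tendsto _).comp
      ((continuousAt_const.add continuousAt_id).inv₀
        (show (1 : ℝ) + id 1 ≠ 0 by norm_num)).tendsto).mono_left
      (nhdsWithin_le_nhds (s := Set.Iio (1 : ℝ))))
  rw [zero_mul] at h
  refine h.congr fun x => ?_
  simp [swap]
  ring

lemma tendsto_iter_mul_iter_swap_zero {u : List Vertex} (hu : u ≠ []) (v : List Vertex) :
    Tendsto (fun x => iter u x * iter v (swap x)) (𝓝[>] 0) (𝓝 0) := by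
  refine ((tendsto_iter_mul_iter_swap_one v hu).comp tendsto_swap_zero).congr' ?_
  filter_upwards [self_mem_nhdsWithin] with x hx
  simp only [Function.comp, swap_swap hx]
  ring

/-- The transformation of iterated integrals under `x ↦ (1 - x) / (1 + x)`. -/
lemma val_eq_neg_pull {a b c : Vertex} (ha : a ≠ root 0) (hc : c ≠ zero) :
    val [a, b, c] = -pull val [c, b, a] := by
  have tone : ∀ (u : List Vertex) {w : List Vertex}, w ≠ [] →
      Tendsto (fun x => iter u x * coiter w x) (𝓝[<] 1) (𝓝 0) := by
    intro u w hw
    simp only [coiter, ← pull_mul]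
    rw [← pull_zero w]
    refine tendsto_pull w fun v hv => tendsto_iter_mul_iter_swap_one u ?_
    rintro rfl
    exact hw (List.length_eq_zero_iff.1 hv.symm)
  have tzero : ∀ {u : List Vertex} (w : List Vertex), u ≠ [] →
      Tendsto (fun x => iter u x * coiter w x) (𝓝[>] 0) (𝓝 0) := by
    intro u w hu
    simp only [coiter, ← pull_mul]
    rw [← pull_zero w]
    exact tendsto_pull w fun v _ => tendsto_iter_mul_iter_swap_zero hu v
  have tco : Tendsto (coiter [c, b, a]) (𝓝[>] 0) (𝓝 (pull val [c, b, a])) := by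
    have key : ∀ d, d ≠ root 0 → ∀ v, Tendsto (fun x => iter (d :: v) (swap x)) (𝓝[>] 0)
        (𝓝 (val (d :: v))) := fun d hd v =>
      (tendsto_iter_one (w := d :: v) (by simpa [NoPoleAtOne])).comp tendsto_swap_zero
    have hrc : refl c ≠ root 0 := by
      rcases c with - | - | k
      · exact absurd rfl hc
      · simp [refl]
      · fin_cases k <;> simp [refl]
    exact (tendsto_pull [b, a] fun v _ => key (refl c) hrc v).sub
      (tendsto_pull [b, a] fun v _ => key (root 2) (by simp) v)
  have tabc := tendsto_iter_one (w := [a, b, c]) (by simpa [NoPoleAtOne])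
  have tone' := tone [] (w := [c, b, a]) (by simp)
  simp only [iter_nil, one_mul] at tone'
  have h := eq_of_tendsto_of_hasDerivAt_zero
    (f := fun x => iter [a, b, c] x - iter [b, c] x * coiter [a] x + iter [c] x * coiter [b, a] x
      - coiter [c, b, a] x) (fun x hx0 hx => ?_)
    (((((tendsto_iter_zero (w := [a, b, c]) (by simp)).mono_left nhdsWithin_le_nhds).sub
      (tzero [a] (by simp))).add (tzero [b, a] (by simp))).sub tco)
    (((tabc.sub (tone [b, c] (by simp))).add (tone [c] (by simp))).sub tone')
  · simpa using h.symm
  · have dd := (((hasDerivAt_iter_cons a (w := [b, c]) (by simp) hx0 hx).sub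
      ((hasDerivAt_iter_cons b (w := [c]) (by simp) hx0 hx).mul
        (hasDerivAt_coiter_cons a (w := []) (Or.inl ha) hx0 hx))).add
      ((hasDerivAt_iter_cons c (w := []) (Or.inl hc) hx0 hx).mul
        (hasDerivAt_coiter_cons b (w := [a]) (by simp) hx0 hx))).sub
      (hasDerivAt_coiter_cons c (w := [b, a]) (by simp) hx0 hx)
    refine dd.congr_deriv ?_
    simp only [iter_nil, coiter, pull]
    ring

lemma forall_vertex {p : Vertex → Prop} :
    (∀ a, p a) ↔ p zero ∧ p inf ∧ p (root 0) ∧ p (root 1) ∧ p (root 2) ∧ p (root 3) := by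
  refine ⟨fun h => by simp [h], fun h a => ?_⟩
  rcases a with - | - | k
  · exact h.1
  · exact h.2.1
  · fin_cases k <;> simp [h]

lemma slope_root_add (k l : Fin 4) :
    (root (k + l)).slope = (root k).slope * (root l).slope := by
  rw [slope, slope, slope, ← pow_add, Fin.val_add, ← Complex.I_pow_eq_pow_mod]

/-- The word attached to a list of exponents, lowered by one, and arguments of a multiple
polylogarithm, the arguments being written as powers of `I`. -/
def word : Fin 4 → List (ℕ × Fin 4) → List Vertex
  | _, [] => []
  | p, (s, k) :: t => List.replicate s zero ++ root (p + k) :: word (p + k) t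

/-- The list of exponents and arguments encoded by a list of pairs `(s, k)`, which stand for the
exponent `s + 1` and the argument `I ^ k`. -/
noncomputable def args (l : List (ℕ × Fin 4)) : List (ℕ × ℂ) :=
  l.map fun q => (q.1 + 1, (root q.2).slope)

lemma coef_replicate (s : ℕ) (w : List Vertex) (n : ℕ) :
    coef (List.replicate s zero ++ w) n = (-1) ^ s * coef w n / n ^ s := by
  induction s with
  | zero => simp
  | succ s ih =>
    rw [List.replicate_succ, List.cons_append, coef, ih, pow_succ, pow_succ, ← div_div]
    ring

lemma sum_coef_word (p : Fin 4) (l : List (ℕ × Fin 4)) (m : ℕ) :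
    ∑ k ∈ Finset.range (m + 1), ((root p).slope ^ k)⁻¹ * coef (word p l) k
      = (-1) ^ (l.map Prod.fst).sum * mpvPartial (args l) (m + 1) := by
  have hp : ∀ k, (root k).slope ≠ 0 := fun k => by simp [slope]
  induction l generalizing p m with
  | nil => simp [word, args, mpvPartial, coef]
  | cons q t ih =>
    obtain ⟨s, k⟩ := q
    rw [Finset.range_eq_Ico, Finset.sum_eq_sum_Ico_succ_bot (by omega)]
    have h0 : coef (word p ((s, k) :: t)) 0 = 0 := by
      cases s <;> simp [word, List.replicate_succ, coef_cons_zero]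
    rw [h0, mul_zero, zero_add,
      show args ((s, k) :: t) = (s + 1, (root k).slope) :: args t from rfl, mpvPartial,
      Finset.mul_sum]
    refine Finset.sum_congr rfl fun n hn => ?_
    obtain ⟨j, rfl⟩ :=
      Nat.exists_eq_succ_of_ne_zero (Nat.one_le_iff_ne_zero.1 (Finset.mem_Ico.1 hn).1)
    have h1 : ∑ i ∈ Finset.range (j + 1),
        (root (p + k)).slope ^ (j + 1 - i) * coef (word (p + k) t) i
        = (root (p + k)).slope ^ (j + 1)
          * ((-1) ^ (t.map Prod.fst).sum * mpvPartial (args t) (j + 1)) := by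
      rw [← ih, Finset.mul_sum]
      refine Finset.sum_congr rfl fun i hi => ?_
      rw [pow_sub₀ _ (hp _) (Finset.mem_range.1 hi).le]
      ring
    rw [word, coef_replicate, coef_cons (by simp), Nat.succ_eq_add_one, h1, slope_root_add]
    have := hp p
    have h2 : ((j + 1 : ℕ) : ℂ) ≠ 0 := by exact_mod_cast j.succ_ne_zero
    simp only [List.map_cons, List.sum_cons, pow_add, mul_pow]
    field_simp

lemma tendsto_mpvPartial {l : List (ℕ × Fin 4)} (hl : NoPoleAtOne (word 0 l)) :
    Tendsto (mpvPartial (args l)) atTop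
      (𝓝 ((-1) ^ (l.map Prod.fst).sum * val (word 0 l))) := by
  rw [← tendsto_add_atTop_iff_nat 1]
  refine (((tendsto_add_atTop_iff_nat 1).2 (tendsto_partialSum hl)).const_mul
    ((-1 : ℂ) ^ (l.map Prod.fst).sum)).congr fun m => ?_
  have h := sum_coef_word 0 l m
  simp only [slope_root_zero, one_pow, inv_one, one_mul] at h
  rw [h, ← mul_assoc, ← mul_pow]
  simp

lemma Li_args {l : List (ℕ × Fin 4)} (hl : NoPoleAtOne (word 0 l)) :
    Li (args l) = (-1) ^ (l.map Prod.fst).sum * val (word 0 l) :=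
  (tendsto_mpvPartial hl).limUnder_eq

lemma val_of_inf_mem {w : List Vertex} (hw : inf ∈ w) : val w = 0 := by
  simp only [val, coef_of_inf_mem hw, Finset.sum_const_zero]
  exact tendsto_const_nhds.limUnder_eq

lemma mpvPartial_cons_succ (s : ℕ) (z : ℂ) (t : List (ℕ × ℂ)) (m : ℕ) :
    mpvPartial ((s, z) :: t) (m + 1 + 1)
      = mpvPartial ((s, z) :: t) (m + 1)
        + z ^ (m + 1) / ((m + 1 : ℕ) : ℂ) ^ s * mpvPartial t (m + 1) := by
  rw [mpvPartial, Finset.sum_Ico_succ_top (by omega), mpvPartial]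

lemma mpvPartial_cons_one (s : ℕ) (z : ℂ) (t : List (ℕ × ℂ)) :
    mpvPartial ((s, z) :: t) 1 = 0 := by
  simp [mpvPartial]

lemma mpvPartial_mul_mpvPartial (r s : ℕ) (x y : ℂ) (m : ℕ) :
    mpvPartial [(r, x)] (m + 1) * mpvPartial [(s, y)] (m + 1)
      = mpvPartial [(r, x), (s, y)] (m + 1) + mpvPartial [(s, y), (r, x)] (m + 1)
        + mpvPartial [(r + s, x * y)] (m + 1) := by
  induction m with
  | zero => simp [mpvPartial_cons_one]
  | succ m ih =>
    simp only [mpvPartial_cons_succ, mul_pow, pow_add _ r s, mpvPartial.eq_1] at ih ⊢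
    linear_combination ih

lemma mpvPartial_mul_mpvPartial_pair (r s t : ℕ) (x y z : ℂ) (m : ℕ) :
    mpvPartial [(r, x)] (m + 1) * mpvPartial [(s, y), (t, z)] (m + 1)
      = mpvPartial [(r, x), (s, y), (t, z)] (m + 1) + mpvPartial [(s, y), (r, x), (t, z)] (m + 1)
        + mpvPartial [(s, y), (t, z), (r, x)] (m + 1) + mpvPartial [(r + s, x * y), (t, z)] (m + 1)
        + mpvPartial [(s, y), (r + t, x * z)] (m + 1) := by
  induction m with
  | zero => simp [mpvPartial_cons_one]
  | succ m ih =>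
    have h := mpvPartial_mul_mpvPartial r t x z m
    simp only [mpvPartial_cons_succ _ _ _ m, mul_pow, pow_add _ r s, mpvPartial.eq_1] at ih ⊢
    linear_combination ih + y ^ (m + 1) / ((m + 1 : ℕ) : ℂ) ^ s * h

lemma val_mul_val_stuffle_pair {a b : Fin 4} (ha : a ≠ 0) (hb : b ≠ 0) (c : Fin 4) :
    val [root a] * val [root b, root (b + c)]
      = val [root a, root (a + b), root (a + b + c)] + val [root b, root (b + a), root (b + a + c)]
        + val [root b, root (b + c), root (b + c + a)] - val [zero, root (a + b), root (a + b + c)]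
        - val [root b, zero, root (b + (a + c))] := by
  have key : ∀ l : List (ℕ × Fin 4), NoPoleAtOne (word 0 l) →
    Tendsto (fun m => mpvPartial (args l) (m + 1)) atTop
      (𝓝 ((-1) ^ (l.map Prod.fst).sum * val (word 0 l))) := fun l hl =>
    (tendsto_add_atTop_iff_nat 1).2 (tendsto_mpvPartial hl)
  have h1 := key [(0, a)] (by simpa [NoPoleAtOne, word])
  have h2 := key [(0, b), (0, c)] (by simpa [NoPoleAtOne, word])
  have h3 := key [(0, a), (0, b), (0, c)] (by simpa [NoPoleAtOne, word])
  have h4 := key [(0, b), (0, a), (0, c)] (by simpa [NoPoleAtOne, word])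
  have h5 := key [(0, b), (0, c), (0, a)] (by simpa [NoPoleAtOne, word])
  have h6 := key [(1, a + b), (0, c)] (by simp [NoPoleAtOne, word])
  have h7 := key [(0, b), (1, a + c)] (by simpa [NoPoleAtOne, word])
  have h := tendsto_nhds_unique (h1.mul h2)
    (((((h3.add h4).add h5).add h6).add h7).congr fun m => ?_)
  · simp [word] at h
    rw [h]; ring
  · simp only [args, List.map_cons, List.map_nil, slope_root_add]
    exact (mpvPartial_mul_mpvPartial_pair ..).symm

lemma val_mul_val_stuffle {a : Fin 4} (ha : a ≠ 0) (b : Fin 4) :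
    val [root a] * val [zero, root b]
      = val [root a, zero, root (a + b)] + val [zero, root b, root (b + a)]
        - val [zero, zero, root (a + b)] := by
  have key : ∀ l : List (ℕ × Fin 4), NoPoleAtOne (word 0 l) →
    Tendsto (fun m => mpvPartial (args l) (m + 1)) atTop
      (𝓝 ((-1) ^ (l.map Prod.fst).sum * val (word 0 l))) := fun l hl =>
    (tendsto_add_atTop_iff_nat 1).2 (tendsto_mpvPartial hl)
  have h1 := key [(0, a)] (by simpa [NoPoleAtOne, word])
  have h2 := key [(1, b)] (by simp [NoPoleAtOne, word])
  have h3 := key [(0, a), (1, b)] (by simpa [NoPoleAtOne, word])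
  have h4 := key [(1, b), (0, a)] (by simp [NoPoleAtOne, word])
  have h5 := key [(2, a + b)] (by simp [NoPoleAtOne, word, List.replicate_succ])
  have h := tendsto_nhds_unique (h1.mul h2) (((h3.add h4).add h5).congr fun m => ?_)
  · simp [word, List.replicate_succ] at h
    linear_combination -h
  · simp only [args, List.map_cons, List.map_nil, slope_root_add]
    exact (mpvPartial_mul_mpvPartial ..).symm

lemma mpvPartial_distribution (s m : ℕ) :
    mpvPartial [(s + 1, -1)] (m + 1)
      = 2 ^ s * (mpvPartial [(s + 1, Complex.I)] (2 * m + 1)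
        + mpvPartial [(s + 1, -Complex.I)] (2 * m + 1)) := by
  induction m with
  | zero => simp [mpvPartial_cons_one]
  | succ m ih =>
    have h1 : (Complex.I) ^ (2 * m + 1) = (-1) ^ m * Complex.I := by
      rw [pow_succ, pow_mul, Complex.I_sq]
    have h2 : (-Complex.I) ^ (2 * m + 1) = -((-1) ^ m * Complex.I) := by
      rw [Odd.neg_pow ⟨m, rfl⟩, h1]
    have h3 : ((2 * m + 1 + 1 : ℕ) : ℂ) = 2 * ((m + 1 : ℕ) : ℂ) := by push_cast; ring
    have h4 : ((m + 1 : ℕ) : ℂ) ≠ 0 := by exact_mod_cast m.succ_ne_zero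
    rw [show 2 * (m + 1) = 2 * m + 1 + 1 by ring]
    simp only [mpvPartial_cons_succ, mpvPartial.eq_1, pow_succ _ (2 * m + 1), h1, h2]
    rw [ih, h3, mul_pow]
    field_simp
    ring_nf
    simp only [Complex.I_sq]
    ring

lemma val_distribution (s : ℕ) :
    val (word 0 [(s, 2)]) = 2 ^ s * (val (word 0 [(s, 1)]) + val (word 0 [(s, 3)])) := by
  have key : ∀ k : Fin 4, k ≠ 0 → Tendsto (fun m => mpvPartial (args [(s, k)]) (m + 1)) atTop
      (𝓝 ((-1) ^ s * val (word 0 [(s, k)]))) := fun k hk =>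
    (tendsto_add_atTop_iff_nat 1).2 (by
      simpa using tendsto_mpvPartial (l := [(s, k)])
        (by cases s <;> simp [NoPoleAtOne, word, hk, List.replicate_succ]))
  have h2 : Tendsto (fun m : ℕ => 2 * m) atTop atTop :=
    tendsto_id.const_mul_atTop' (by norm_num)
  have h := tendsto_nhds_unique (key 2 (by decide))
    (((((key 1 (by decide)).comp h2).add ((key 3 (by decide)).comp h2)).const_mul
      ((2 : ℂ) ^ s)).congr fun m => ?_)
  · have h0 : ((-1 : ℂ) ^ s) ≠ 0 := by simp
    refine mul_left_cancel₀ h0 ?_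
    linear_combination h
  · simp only [args, List.map_cons, List.map_nil, slope_root_one, slope_root_two, slope_root_three,
      Function.comp]
    exact (mpvPartial_distribution s m).symm

set_option maxHeartbeats 4000000 in
/-- The relations between iterated integrals of weight three determine all of them from eight. -/
lemma eq_zero_of_relations {X : Vertex → Vertex → Vertex → ℚ}
    (hinf₁ : ∀ b c, X inf b c = 0) (hinf₂ : ∀ a c, X a inf c = 0) (hinf₃ : ∀ a b, X a b inf = 0)
    (hrefl : ∀ a b c, a ≠ root 0 → c ≠ zero → X a b c =
      X (root 2) (root 2) (root 2) - X (root 2) (root 2) (refl a)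
        - X (root 2) (refl b) (root 2) + X (root 2) (refl b) (refl a)
        - X (refl c) (root 2) (root 2) + X (refl c) (root 2) (refl a)
        + X (refl c) (refl b) (root 2) - X (refl c) (refl b) (refl a))
    (hpair : ∀ a b c : Fin 4, a ≠ 0 → b ≠ 0 →
      X (root a) (root b) (root (b + c)) + X (root b) (root a) (root (b + c))
        + X (root b) (root (b + c)) (root a)
      = X (root a) (root (a + b)) (root (a + b + c)) + X (root b) (root (b + a)) (root (b + a + c))
        + X (root b) (root (b + c)) (root (b + c + a)) - X zero (root (a + b)) (root (a + b + c))
        - X (root b) zero (root (b + (a + c))))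
    (hdepth : ∀ a b : Fin 4, a ≠ 0 →
      X (root a) zero (root b) + X zero (root a) (root b) + X zero (root b) (root a)
      = X (root a) zero (root (a + b)) + X zero (root b) (root (b + a))
        - X zero zero (root (a + b)))
    (hdist₂ : ∀ a : Fin 4, a ≠ 0 →
      X (root a) zero (root 2) + X zero (root a) (root 2) + X zero (root 2) (root a)
      = 2 * (X (root a) zero (root 1) + X zero (root a) (root 1) + X zero (root 1) (root a))
        + 2 * (X (root a) zero (root 3) + X zero (root a) (root 3) + X zero (root 3) (root a)))
    (hdist₁ : X (root 2) (root 1) (root 0) + X (root 1) (root 2) (root 0)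
        + X (root 1) (root 0) (root 2)
      = X (root 1) (root 1) (root 0) + X (root 1) (root 1) (root 0) + X (root 1) (root 0) (root 1)
        + (X (root 3) (root 1) (root 0) + X (root 1) (root 3) (root 0)
          + X (root 1) (root 0) (root 3)))
    (h₁ : X (root 1) (root 1) (root 1) = 0) (h₂ : X (root 2) (root 0) (root 1) = 0)
    (h₃ : X (root 1) (root 2) (root 3) = 0) (h₄ : X (root 3) zero (root 0) = 0)
    (h₅ : X (root 3) (root 1) (root 1) = 0) (h₆ : X (root 3) (root 3) (root 3) = 0)
    (h₇ : X (root 1) (root 2) (root 0) = 0) (h₈ : X zero (root 3) (root 3) = 0) :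
    ∀ a b c, a ≠ root 0 → c ≠ zero → X a b c = 0 := by
  simp only [forall_vertex, Fin.forall_fin_succ] at hrefl hpair hdepth hdist₂ ⊢
  simp [refl, hinf₁, hinf₂, hinf₃, h₁, h₂, h₃, h₄, h₅, h₆, h₇, h₈]
    at hrefl hpair hdepth hdist₂ hdist₁ ⊢
  clear hinf₁ hinf₂ hinf₃
  have h₁₂₂ : X (root 1) (root 2) (root 2) = 0 := by
    grind -linarith
  have h₂₂₀ : X (root 2) (root 2) (root 0) = 0 := by
    grind -linarith
  have h₂₂₂ : X (root 2) (root 2) (root 2) = 0 := by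
    grind -linarith
  have h₂₃₂ : X (root 2) (root 3) (root 2) = 0 := by
    grind -linarith
  have h₂₁₃ : X (root 2) (root 1) (root 3) = 0 := by
    grind -linarith
  have h₂z₂ : X (root 2) zero (root 2) = 0 := by
    grind -linarith
  have h₂₁₀ : X (root 2) (root 1) (root 0) = 0 := by
    grind -linarith
  have h₁₂₁ : X (root 1) (root 2) (root 1) = 0 := by
    grind -linarith
  have h₂₃₁ : X (root 2) (root 3) (root 1) = 0 := by
    grind -linarith
  simp only [h₁₂₂, h₂₂₀, h₂₂₂, h₂₃₂, h₂₁₃, h₂z₂, h₂₁₀, h₁₂₁, h₂₃₁, sub_zero, add_zero, zero_add,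
    zero_sub, true_and, and_true] at hrefl hpair hdepth hdist₂ hdist₁ ⊢
  and_intros <;> grind -linarith

/-- A linear functional on the iterated integrals of weight three is determined by its values on
eight of them. -/
lemma map_val_eq_zero (f : ℂ →ₗ[ℚ] ℚ)
    (h₁ : f (val [root 1, root 1, root 1]) = 0) (h₂ : f (val [root 2, root 0, root 1]) = 0)
    (h₃ : f (val [root 1, root 2, root 3]) = 0) (h₄ : f (val [root 3, zero, root 0]) = 0)
    (h₅ : f (val [root 3, root 1, root 1]) = 0) (h₆ : f (val [root 3, root 3, root 3]) = 0)
    (h₇ : f (val [root 1, root 2, root 0]) = 0) (h₈ : f (val [zero, root 3, root 3]) = 0)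
    {a b c : Vertex} (ha : a ≠ root 0) (hc : c ≠ zero) : f (val [a, b, c]) = 0 := by
  have hshuffle : ∀ a b c : Vertex, a ≠ zero → a ≠ root 0 → b ≠ root 0 → c ≠ zero →
      f (val [a] * val [b, c]) = f (val [a, b, c]) + f (val [b, a, c]) + f (val [b, c, a]) :=
    fun a b c ha ha' hb hc => by rw [val_mul_val_shuffle ha ha' hb hc, map_add, map_add]
  refine eq_zero_of_relations (X := fun a b c => f (val [a, b, c])) ?_ ?_ ?_ ?_ ?_ ?_ ?_ ?_
    h₁ h₂ h₃ h₄ h₅ h₆ h₇ h₈ a b c ha hc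
  · intro b c
    rw [val_of_inf_mem (by simp), map_zero]
  · intro a c
    rw [val_of_inf_mem (by simp), map_zero]
  · intro a b
    rw [val_of_inf_mem (by simp), map_zero]
  · intro a b c ha hc
    simp only [val_eq_neg_pull ha hc, pull, map_neg, map_sub]
    ring
  · intro a b c ha hb
    rw [← hshuffle _ _ _ (by simp) (by simpa) (by simpa) (by simp),
      val_mul_val_stuffle_pair ha hb c]
    simp only [map_add, map_sub]
  · intro a b ha
    rw [← hshuffle _ _ _ (by simp) (by simpa) (by simp) (by simp), val_mul_val_stuffle ha b]
    simp only [map_add, map_sub]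
  · intro a ha
    have hd : val [zero, root 2] = (2 : ℚ) • (val [zero, root 1] + val [zero, root 3]) := by
      simpa [word, Rat.smul_def, mul_add] using val_distribution 1
    have h := congrArg (fun z => f (val [root a] * z)) hd
    simp only [mul_smul_comm, mul_add, map_smul, map_add] at h
    rw [hshuffle (root a) zero, hshuffle (root a) zero, hshuffle (root a) zero] at h <;>
      try simp [ha]
    rw [h, smul_eq_mul, mul_add]
  · have hd : val [root 2] = val [root 1] + val [root 3] := by
      simpa [word] using val_distribution 0
    have h := congrArg (fun z => f (z * val [root 1, root 0])) hd
    simp only [add_mul, map_add] at h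
    rwa [hshuffle, hshuffle, hshuffle] at h <;> simp

end Vertex

open Vertex

lemma exists_slope_eq {z : ℂ} (hz : z ^ 4 = 1) : ∃ k : Fin 4, z = (root k).slope := by
  have h : (z - 1) * (z + 1) * ((z - Complex.I) * (z + Complex.I)) = 0 := by
    linear_combination hz + (1 - z ^ 2) * Complex.I_sq
  rcases mul_eq_zero.1 h with h | h <;> rcases mul_eq_zero.1 h with h | h
  · exact ⟨0, by rw [slope_root_zero]; linear_combination h⟩
  · exact ⟨2, by rw [slope_root_two]; linear_combination h⟩
  · exact ⟨1, by rw [slope_root_one]; linear_combination h⟩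
  · exact ⟨3, by rw [slope_root_three]; linear_combination h⟩

lemma exists_args_eq {l : List (ℕ × ℂ)} (hl : ∀ q ∈ l, 0 < q.1 ∧ q.2 ^ 4 = 1) :
    ∃ l' : List (ℕ × Fin 4), l = args l' := by
  induction l with
  | nil => exact ⟨[], rfl⟩
  | cons q t ih =>
    obtain ⟨t', rfl⟩ := ih fun q hq => hl q (List.mem_cons_of_mem _ hq)
    obtain ⟨h0, h4⟩ := hl q List.mem_cons_self
    obtain ⟨k, hk⟩ := exists_slope_eq h4
    refine ⟨(q.1 - 1, k) :: t', ?_⟩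
    rw [show args ((q.1 - 1, k) :: t') = (q.1 - 1 + 1, (root k).slope) :: args t' from rfl,
      Nat.sub_add_cancel h0, ← hk]

lemma length_word (p : Fin 4) (l : List (ℕ × Fin 4)) :
    (word p l).length = ((args l).map Prod.fst).sum := by
  induction l generalizing p with
  | nil => rfl
  | cons q t ih =>
    rw [word, args, List.map_cons, ← args, List.map_cons, List.sum_cons, List.length_append,
      List.length_replicate, List.length_cons, ih]
    ring

lemma getLast?_word (p : Fin 4) (l : List (ℕ × Fin 4)) : (word p l).getLast? ≠ some zero := by
  induction l generalizing p with
  | nil => simp [word]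
  | cons q t ih =>
    have := ih (p + q.2)
    rw [word, List.getLast?_append, List.getLast?_cons]
    cases h : (word (p + q.2) t).getLast? <;> simp_all

lemma noPoleAtOne_word {l : List (ℕ × Fin 4)} (hl : (args l).head? ≠ some (1, 1)) :
    NoPoleAtOne (word 0 l) := by
  rcases l with - | ⟨⟨s, k⟩, t⟩
  · simp [NoPoleAtOne, word]
  · rcases s with - | s
    · suffices k ≠ 0 by simpa [NoPoleAtOne, word]
      rintro rfl
      simp [args, slope_root_zero] at hl
    · simp [NoPoleAtOne, word, List.replicate_succ]

/-- The values of weight three and level four are iterated integrals up to sign. -/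
lemma exists_val_of_mem_MPVset {x : ℂ} (hx : x ∈ MPVset 3 4) :
    ∃ a b c, a ≠ root 0 ∧ c ≠ zero ∧ (x = val [a, b, c] ∨ x = -val [a, b, c]) := by
  obtain ⟨l, hl, hw, hh, rfl⟩ := hx
  obtain ⟨l, rfl⟩ := exists_args_eq hl
  have hp := noPoleAtOne_word hh
  obtain ⟨a, b, c, habc⟩ := List.length_eq_three.1 ((length_word 0 l).trans hw)
  have hlast := getLast?_word 0 l
  rw [Li_args hp]
  rw [habc] at hp hlast ⊢
  refine ⟨a, b, c, by simpa [NoPoleAtOne] using hp, by simpa using hlast, ?_⟩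
  rcases neg_one_pow_eq_or ℂ (l.map Prod.fst).sum with h | h <;> simp [h]

open Complex in
/-- every multiple polylogarithm value of weight 3 and level 4 is a
`ℚ`-linear combination of the eight values `Li_{1,1,1}(i,1,1)`, `Li_{1,1,1}(−1,−1,i)`,
`Li_{1,1,1}(i,i,i)`, `Li_{1,2}(−i,i)`, `Li_{1,1,1}(−i,−1,1)`, `Li_{1,1,1}(−i,1,1)`,
`Li_{1,1,1}(i,i,−1)`, `Li_{2,1}(−i,1)`; in particular `d(3,4) ≤ 8`. -/
theorem mpv_weight3_level4_span_eight :
    MPVset 3 4 ⊆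
      (Submodule.span ℚ
        ({Li [(1, I), (1, 1), (1, 1)],
          Li [(1, -1), (1, -1), (1, I)],
          Li [(1, I), (1, I), (1, I)],
          Li [(1, -I), (2, I)],
          Li [(1, -I), (1, -1), (1, 1)],
          Li [(1, -I), (1, 1), (1, 1)],
          Li [(1, I), (1, I), (1, -1)],
          Li [(2, -I), (1, 1)]} : Set ℂ) : Set ℂ)
    ∧ Module.rank ℚ ↥(MPV 3 4) ≤ 8 := by
  set S : Set ℂ := {Li [(1, I), (1, 1), (1, 1)], Li [(1, -1), (1, -1), (1, I)],
    Li [(1, I), (1, I), (1, I)], Li [(1, -I), (2, I)], Li [(1, -I), (1, -1), (1, 1)],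
    Li [(1, -I), (1, 1), (1, 1)], Li [(1, I), (1, I), (1, -1)], Li [(2, -I), (1, 1)]} with hS
  have hsub : MPVset 3 4 ⊆ (Submodule.span ℚ S : Set ℂ) := by
    intro x hx
    obtain ⟨a, b, c, ha, hc, habc⟩ := exists_val_of_mem_MPVset hx
    by_contra hxS
    obtain ⟨f, hfx, hf⟩ := Submodule.exists_le_ker_of_notMem hxS
    have hfS : ∀ l : List (ℕ × Fin 4), Li (args l) ∈ S → NoPoleAtOne (word 0 l) →
        f (val (word 0 l)) = 0 := by
      intro l hl hp
      have h : f (Li (args l)) = 0 := hf (Submodule.subset_span hl)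
      rw [Li_args hp] at h
      rcases neg_one_pow_eq_or ℂ (l.map Prod.fst).sum with h' | h' <;> simpa [h'] using h
    have h0 : f (val [a, b, c]) = 0 := by
      refine map_val_eq_zero f ?_ ?_ ?_ ?_ ?_ ?_ ?_ ?_ ha hc
      · exact hfS [(0, 1), (0, 0), (0, 0)]
          (by simp [hS, args, slope_root_zero, slope_root_one]) (by simp [NoPoleAtOne, word])
      · exact hfS [(0, 2), (0, 2), (0, 1)]
          (by simp [hS, args, slope_root_two, slope_root_one]) (by simp [NoPoleAtOne, word])
      · exact hfS [(0, 1), (0, 1), (0, 1)]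
          (by simp [hS, args, slope_root_one]) (by simp [NoPoleAtOne, word])
      · exact hfS [(0, 3), (1, 1)]
          (by simp [hS, args, slope_root_three, slope_root_one]) (by simp [NoPoleAtOne, word])
      · exact hfS [(0, 3), (0, 2), (0, 0)]
          (by simp [hS, args, slope_root_three, slope_root_two, slope_root_zero])
          (by simp [NoPoleAtOne, word])
      · exact hfS [(0, 3), (0, 0), (0, 0)]
          (by simp [hS, args, slope_root_three, slope_root_zero]) (by simp [NoPoleAtOne, word])
      · exact hfS [(0, 1), (0, 1), (0, 2)]
          (by simp [hS, args, slope_root_one, slope_root_two]) (by simp [NoPoleAtOne, word])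
      · exact hfS [(1, 3), (0, 0)]
          (by simp [hS, args, slope_root_three, slope_root_zero])
          (by simp [NoPoleAtOne, word, List.replicate_succ])
    rcases habc with rfl | rfl <;> simp [h0] at hfx
  refine ⟨hsub, ?_⟩
  calc Module.rank ℚ ↥(MPV 3 4) ≤ Module.rank ℚ ↥(Submodule.span ℚ S) :=
        Submodule.rank_mono (Submodule.span_le.2 hsub)
    _ ≤ Cardinal.mk S := rank_span_le S
    _ ≤ 8 := by
      have h : ∀ {n : ℕ} {a : ℂ} {s : Set ℂ}, Cardinal.mk s ≤ n →
          Cardinal.mk (insert a s : Set ℂ) ≤ (n + 1 : ℕ) := fun hs =>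
        Cardinal.mk_insert_le.trans (by push_cast; gcongr)
      exact h (h (h (h (h (h (h (n := 1) (by simp)))))))
end
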